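/- arXiv:1908.06529 — 3 statements merged into one kernel-verified Lean document; each statement's English description precedes it below -/
import Mathlib

section
/- Let 1 ≤ p < ∞ and let Φ : c00 → c00 be a homogeneous support-preserving map which is a centralizer on ℓ_p, i.e., there is a constant C such that ‖Φ(a·x) − a·Φ(x)‖_p ≤ C‖a‖_∞‖x‖_p for every bounded sequence a : ℕ → ℝ and every x ∈ c00. Then there exist a homogeneous map H : c00 → ℓ_p and a constant K such that ‖H(x+x') − H(x) − H(x') − Φ(Φ(x+x') − Φ(x) − Φ(x'))‖_p ≤ K(‖x‖_p + ‖x'‖_p) for all x, x' ∈ c00. (This is the concrete content of the fact that the concatenation Φ·Φ of any centralizer on ℓ_p with itself is trivial in Ext²(ℓ_p, ℓ_p).) -/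
/-- `x : ℕ → ℝ` is finitely supported (i.e. belongs to `c00`). -/
def FinSupp (x : ℕ → ℝ) : Prop := (Function.support x).Finite

/-- The `ℓ_p` norm of a sequence, `‖x‖_p = (∑ₙ |x n|^p)^(1/p)`. -/
noncomputable def pNorm (p : ℝ) (x : ℕ → ℝ) : ℝ := (∑' n, |x n| ^ p) ^ (1 / p)

/-- The `ℓ_q` norm of the restriction of a sequence to a finite set of indices. -/
noncomputable def lpOn (S : Finset ℕ) (q : ℝ) (f : ℕ → ℝ) : ℝ :=
  (∑ n ∈ S, |f n| ^ q) ^ (1 / q)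

lemma sum_abs_rpow_nonneg (S : Finset ℕ) (q : ℝ) (f : ℕ → ℝ) : 0 ≤ ∑ n ∈ S, |f n| ^ q :=
  Finset.sum_nonneg fun _ _ => Real.rpow_nonneg (abs_nonneg _) _

lemma lpOn_nonneg (S : Finset ℕ) (q : ℝ) (f : ℕ → ℝ) : 0 ≤ lpOn S q f :=
  Real.rpow_nonneg (sum_abs_rpow_nonneg S q f) _

lemma lpOn_rpow {S : Finset ℕ} {q : ℝ} (hq : 0 < q) (f : ℕ → ℝ) :
    lpOn S q f ^ q = ∑ n ∈ S, |f n| ^ q := by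
  rw [lpOn, ← Real.rpow_mul (sum_abs_rpow_nonneg S q f), one_div, inv_mul_cancel₀ hq.ne',
    Real.rpow_one]

lemma lpOn_le_iff {S : Finset ℕ} {q r : ℝ} (hq : 0 < q) (hr : 0 ≤ r) (f : ℕ → ℝ) :
    lpOn S q f ≤ r ↔ ∑ n ∈ S, |f n| ^ q ≤ r ^ q := by
  rw [← lpOn_rpow hq, Real.rpow_le_rpow_iff (lpOn_nonneg S q f) hr hq]

lemma lpOn_mono {S : Finset ℕ} {q : ℝ} (hq : 0 < q) {f g : ℕ → ℝ}
    (h : ∀ n ∈ S, |f n| ≤ |g n|) : lpOn S q f ≤ lpOn S q g := by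
  rw [lpOn_le_iff hq (lpOn_nonneg _ _ _), lpOn_rpow hq]
  exact Finset.sum_le_sum fun n hn => Real.rpow_le_rpow (abs_nonneg _) (h n hn) hq.le

lemma lpOn_zero {S : Finset ℕ} {q : ℝ} (hq : 0 < q) {f : ℕ → ℝ} (h : ∀ n ∈ S, f n = 0) :
    lpOn S q f = 0 := by
  refine le_antisymm ?_ (lpOn_nonneg _ _ _)
  rw [lpOn_le_iff hq le_rfl, Real.zero_rpow hq.ne']
  exact (Finset.sum_eq_zero fun n hn => by rw [h n hn, abs_zero, Real.zero_rpow hq.ne']).le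

lemma abs_le_lpOn {S : Finset ℕ} {q : ℝ} (hq : 0 < q) (f : ℕ → ℝ) {n : ℕ} (hn : n ∈ S) :
    |f n| ≤ lpOn S q f := by
  rw [← Real.rpow_le_rpow_iff (abs_nonneg _) (lpOn_nonneg _ _ _) hq, lpOn_rpow hq]
  exact Finset.single_le_sum (f := fun n => |f n| ^ q)
    (fun _ _ => Real.rpow_nonneg (abs_nonneg _) _) hn

lemma lpOn_const_mul {S : Finset ℕ} {q : ℝ} (hq : 0 < q) (c : ℝ) (f : ℕ → ℝ) :
    lpOn S q (fun n => c * f n) = |c| * lpOn S q f := by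
  unfold lpOn
  simp_rw [abs_mul, Real.mul_rpow (abs_nonneg _) (abs_nonneg _)]
  rw [← Finset.mul_sum, Real.mul_rpow (Real.rpow_nonneg (abs_nonneg _) _)
    (sum_abs_rpow_nonneg S q f), ← Real.rpow_mul (abs_nonneg _), mul_one_div_cancel hq.ne',
    Real.rpow_one]

lemma lpOn_neg {S : Finset ℕ} {q : ℝ} (f : ℕ → ℝ) :
    lpOn S q (fun n => - f n) = lpOn S q f := by
  simp [lpOn]

lemma lpOn_mul_le_of_bounded {S : Finset ℕ} {q : ℝ} (hq : 0 < q) {a f : ℕ → ℝ}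
    (ha : ∀ n ∈ S, |a n| ≤ 1) : lpOn S q (fun n => a n * f n) ≤ lpOn S q f :=
  lpOn_mono hq fun n hn => by
    rw [abs_mul]
    exact mul_le_of_le_one_left (abs_nonneg _) (ha n hn)

lemma lpOn_add_le {S : Finset ℕ} {q : ℝ} (hq : 1 ≤ q) (f g : ℕ → ℝ) :
    lpOn S q (fun n => f n + g n) ≤ lpOn S q f + lpOn S q g :=
  Real.Lp_add_le S f g hq

lemma lpOn_sub_le {S : Finset ℕ} {q : ℝ} (hq : 1 ≤ q) (f g : ℕ → ℝ) :
    lpOn S q (fun n => f n - g n) ≤ lpOn S q f + lpOn S q g := by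
  have := lpOn_add_le (S := S) hq f (fun n => - g n)
  rw [lpOn_neg] at this
  simpa [sub_eq_add_neg] using this

/-- The Cauchy-Schwarz inequality for `ℓ_{2 q} · ℓ_{2 q} ⊆ ℓ_q`. -/
lemma lpOn_mul_le {S : Finset ℕ} {q : ℝ} (hq : 0 < q) (f g : ℕ → ℝ) :
    lpOn S q (fun n => f n * g n) ≤ lpOn S (2 * q) f * lpOn S (2 * q) g := by
  have hnf := lpOn_nonneg S (2 * q) f
  have hng := lpOn_nonneg S (2 * q) g
  have h2q : 0 < 2 * q := by linarith
  rw [lpOn_le_iff hq (by positivity), Real.mul_rpow hnf hng]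
  have hsq : ∀ x : ℝ, 0 ≤ x → (x ^ q) ^ 2 = x ^ (2 * q) := fun x hx => by
    rw [mul_comm, Real.rpow_mul hx, Real.rpow_two]
  simp_rw [abs_mul, Real.mul_rpow (abs_nonneg _) (abs_nonneg _)]
  refine abs_le_of_sq_le_sq' ?_ (by positivity) |>.2
  refine (Finset.sum_mul_sq_le_sq_mul_sq _ _ _).trans_eq ?_
  simp_rw [hsq _ (abs_nonneg _)]
  rw [mul_pow, hsq _ hnf, hsq _ hng, lpOn_rpow h2q, lpOn_rpow h2q]

lemma lpOn_mul_self {S : Finset ℕ} {q : ℝ} (hq : 0 < q) (f : ℕ → ℝ) :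
    lpOn S q (fun n => f n * f n) = lpOn S (2 * q) f ^ 2 := by
  have hsq : ∀ x : ℝ, 0 ≤ x → (x * x) ^ q = x ^ (2 * q) := fun x hx => by
    rw [Real.rpow_mul hx, Real.rpow_two, pow_two]
  unfold lpOn
  simp_rw [abs_mul, hsq _ (abs_nonneg _)]
  rw [← Real.rpow_natCast, ← Real.rpow_mul (sum_abs_rpow_nonneg _ _ _)]
  congr 1
  push_cast
  field_simp

/-- Hölder's inequality with the weight written as a power of a summable sequence. -/
lemma sum_rpow_mul_le {S : Finset ℕ} {p M C : ℝ} (hp : 1 ≤ p) (hC : 0 < C) {m f : ℕ → ℝ}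
    (hm : ∀ n ∈ S, 0 ≤ m n) (hM : ∑ n ∈ S, m n ≤ M) (hf : lpOn S p f ≤ C * M ^ (1 / p)) :
    ∑ n ∈ S, m n ^ (1 - 1 / p) * |f n| ≤ C * M := by
  have hp0 : 0 < p := by linarith
  have hM0 : 0 ≤ M := (Finset.sum_nonneg hm).trans hM
  have h1p : 1 / p ≤ 1 := by rw [div_le_one hp0]; exact hp
  have h1p0 : 0 < 1 / p := by positivity
  have hfp : ∑ n ∈ S, |f n| ^ p ≤ C ^ p * M := by
    rw [lpOn_le_iff hp0 (by positivity), Real.mul_rpow hC.le (by positivity),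
      ← Real.rpow_mul hM0, one_div_mul_cancel hp0.ne', Real.rpow_one] at hf
    exact hf
  have key : ∀ n ∈ S, m n ^ (1 - 1 / p) * |f n| ≤
      C * ((1 - 1 / p) * m n + 1 / p * (|f n| ^ p / C ^ p)) := by
    intro n hn
    have hy := Real.geom_mean_le_arith_mean2_weighted (sub_nonneg.2 h1p) h1p0.le (hm n hn)
      (p₂ := (|f n| / C) ^ p) (by positivity) (by ring)
    rw [← Real.rpow_mul (by positivity), mul_one_div_cancel hp0.ne', Real.rpow_one,
      Real.div_rpow (abs_nonneg _) hC.le] at hy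
    calc m n ^ (1 - 1 / p) * |f n| = C * (m n ^ (1 - 1 / p) * (|f n| / C)) := by
          field_simp
      _ ≤ _ := mul_le_mul_of_nonneg_left hy hC.le
  refine (Finset.sum_le_sum key).trans ?_
  rw [← Finset.mul_sum, Finset.sum_add_distrib, ← Finset.mul_sum, ← Finset.mul_sum,
    ← Finset.sum_div]
  have h2 : (∑ n ∈ S, |f n| ^ p) / C ^ p ≤ M := by
    rw [div_le_iff₀ (by positivity), mul_comm]; exact hfp
  have h3 : (1 - 1 / p) * ∑ n ∈ S, m n + 1 / p * ((∑ n ∈ S, |f n| ^ p) / C ^ p) ≤ M := by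
    nlinarith [mul_le_mul_of_nonneg_left hM (sub_nonneg.2 h1p),
      mul_le_mul_of_nonneg_left h2 h1p0.le]
  exact mul_le_mul_of_nonneg_left h3 hC.le

lemma abs_one_add_rpow_le {s : ℝ} (hs1 : 1 ≤ s) (hs2 : s ≤ 2) (r : ℝ) :
    |1 + r| ^ s ≤ 1 + s * r + 4 * |r| ^ s := by
  rcases le_or_gt |r| 1 with h | h
  · have hr := abs_le.1 h
    have h0 : 0 ≤ 1 + r := by linarith
    have h1 : (1 + r) ^ (s - 1) ≤ 1 + (s - 1) * r :=
      rpow_one_add_le_one_add_mul_self hr.1 (by linarith) (by linarith)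
    have h2 : (1 + r) ^ s = (1 + r) * (1 + r) ^ (s - 1) := by
      rcases h0.eq_or_lt with h0 | h0
      · rw [← h0, Real.zero_rpow (by linarith), zero_mul]
      · rw [← Real.rpow_one_add' h0.le (by linarith)]; congr 1; ring
    have h3 : r ^ 2 ≤ |r| ^ s := by
      rw [← sq_abs, ← Real.rpow_two]
      rcases (abs_nonneg r).eq_or_lt with h' | h'
      · rw [← h', Real.zero_rpow (by linarith), Real.zero_rpow (by linarith)]
      · exact Real.rpow_le_rpow_of_exponent_ge h' h hs2
    rw [abs_of_nonneg h0, h2]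
    nlinarith [mul_le_mul_of_nonneg_left h1 h0, sq_nonneg r]
  · have h1 : |r| ≤ |r| ^ s := Real.self_le_rpow_of_one_le h.le hs1
    have h2 : |r| ^ s ≤ |r| ^ (2 : ℝ) := Real.rpow_le_rpow_of_exponent_le h.le hs2
    rcases abs_cases r with ⟨hr, hr0⟩ | ⟨hr, hr0⟩
    · rw [hr] at h h1 ⊢
      have h3 : |1 + r| ^ s ≤ (2 * r) ^ s :=
        Real.rpow_le_rpow (abs_nonneg _) (by rw [abs_of_nonneg (by linarith)]; linarith)
          (by linarith)
      have h4 : (2 : ℝ) ^ s ≤ 4 := by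
        calc (2 : ℝ) ^ s ≤ 2 ^ (2 : ℝ) := Real.rpow_le_rpow_of_exponent_le (by norm_num) hs2
          _ = 4 := by norm_num
      rw [Real.mul_rpow (by norm_num) hr0] at h3
      have h5 : (2 : ℝ) ^ s * r ^ s ≤ 4 * r ^ s :=
        mul_le_mul_of_nonneg_right h4 (Real.rpow_nonneg hr0 _)
      linarith [mul_nonneg (by linarith : 0 ≤ s) hr0]
    · have h3 : |1 + r| ^ s ≤ |r| ^ s :=
        Real.rpow_le_rpow (abs_nonneg _)
          (by rw [hr] at h ⊢; rw [abs_le]; constructor <;> linarith) (by linarith)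
      nlinarith

/-- Uniform smoothness of the function `|·|^s`, `1 ≤ s ≤ 2`. -/
lemma abs_add_rpow_le {s : ℝ} (hs1 : 1 ≤ s) (hs2 : s ≤ 2) (a b : ℝ) :
    |a + b| ^ s ≤ |a| ^ s + s * (Real.sign a * |a| ^ (s - 1) * b) + 4 * |b| ^ s := by
  rcases eq_or_ne a 0 with rfl | ha
  · have : 0 ≤ |b| ^ s := Real.rpow_nonneg (abs_nonneg _) _
    simp [Real.zero_rpow (by linarith : s ≠ 0)]
    linarith
  · have ha' : 0 < |a| := abs_pos.2 ha
    have h := mul_le_mul_of_nonneg_left (abs_one_add_rpow_le hs1 hs2 (b / a))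
      (Real.rpow_nonneg (abs_nonneg a) s)
    have e1 : |a| ^ s * |1 + b / a| ^ s = |a + b| ^ s := by
      rw [← Real.mul_rpow (abs_nonneg _) (abs_nonneg _), ← abs_mul]
      congr 2; field_simp
    have e2 : |a| ^ s * |b / a| ^ s = |b| ^ s := by
      rw [← Real.mul_rpow (abs_nonneg _) (abs_nonneg _), ← abs_mul]
      congr 2; field_simp
    have e3 : |a| ^ s * (b / a) = Real.sign a * |a| ^ (s - 1) * b := by
      rw [Real.rpow_sub_one ha'.ne']
      rcases ha.lt_or_gt with h | h
      · rw [abs_of_neg h, Real.sign_of_neg h]; field_simp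
      · rw [abs_of_pos h, Real.sign_of_pos h]; field_simp
    rw [e1] at h
    nlinarith

lemma lpOn_add_le_of_sum_eq_zero {S : Finset ℕ} {s : ℝ} (hs1 : 1 ≤ s) (hs2 : s ≤ 2)
    {y z : ℕ → ℝ} (hy : lpOn S s y = 1)
    (hz : ∑ n ∈ S, Real.sign (y n) * |y n| ^ (s - 1) * z n = 0) :
    lpOn S s (fun n => y n + z n) ≤ 1 + 4 * lpOn S s z ^ s := by
  have hs0 : 0 < s := by linarith
  have hz0 : 0 ≤ lpOn S s z ^ s := Real.rpow_nonneg (lpOn_nonneg _ _ _) _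
  have h1 : (1 + 4 * lpOn S s z ^ s) ≤ (1 + 4 * lpOn S s z ^ s) ^ s :=
    Real.self_le_rpow_of_one_le (by linarith) hs1
  rw [lpOn_le_iff hs0 (by positivity)]
  refine le_trans ?_ h1
  refine (Finset.sum_le_sum fun n _ => abs_add_rpow_le hs1 hs2 (y n) (z n)).trans_eq ?_
  rw [Finset.sum_add_distrib, Finset.sum_add_distrib, ← Finset.mul_sum, ← Finset.mul_sum, hz,
    ← lpOn_rpow hs0, ← lpOn_rpow hs0, hy, Real.one_rpow]
  ring

lemma sum_abs_mul_le {S : Finset ℕ} {q r : ℝ} (hqr : q.HolderConjugate r) (f g : ℕ → ℝ) :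
    ∑ n ∈ S, |f n * g n| ≤ lpOn S q f * lpOn S r g := by
  have h := Real.inner_le_Lp_mul_Lq S (fun n => |f n|) (fun n => |g n|) hqr
  simp_rw [abs_abs, ← abs_mul] at h
  exact h

lemma abs_sum_mul_le {S : Finset ℕ} {q r : ℝ} (hqr : q.HolderConjugate r) (f g : ℕ → ℝ) :
    |∑ n ∈ S, f n * g n| ≤ lpOn S q f * lpOn S r g :=
  (Finset.abs_sum_le_sum_abs _ _).trans (sum_abs_mul_le hqr f g)

lemma abs_sign_mul_rpow {r t : ℝ} (ht : t ≠ 0) : |Real.sign r * |r| ^ t| = |r| ^ t := by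
  rcases eq_or_ne r 0 with rfl | hr
  · simp [Real.zero_rpow ht]
  · rw [abs_mul, abs_of_nonneg (Real.rpow_nonneg (abs_nonneg r) t)]
    rcases Real.sign_apply_eq_of_ne_zero r hr with h | h <;> simp [h]

lemma sign_mul_rpow_mul_self {r t : ℝ} (ht : 0 < t) :
    Real.sign r * |r| ^ (t - 1) * r = |r| ^ t := by
  rcases eq_or_ne r 0 with rfl | hr
  · simp [Real.zero_rpow ht.ne']
  · have : Real.sign r * r = |r| := by
      rcases hr.lt_or_gt with h | h
      · rw [Real.sign_of_neg h, abs_of_neg h]; ring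
      · rw [Real.sign_of_pos h, abs_of_pos h]; ring
    rw [mul_right_comm, this, Real.rpow_sub_one (abs_pos.2 hr).ne']
    field_simp [abs_pos.2 hr]

lemma abs_sum_duality_le {S : Finset ℕ} {s : ℝ} (hs : 1 < s) {y : ℕ → ℝ}
    (hy : lpOn S s y = 1) (z : ℕ → ℝ) :
    |∑ n ∈ S, Real.sign (y n) * |y n| ^ (s - 1) * z n| ≤ lpOn S s z := by
  have hc : s.HolderConjugate s.conjExponent := Real.HolderConjugate.conjExponent hs
  have h := abs_sum_mul_le (S := S) hc.symm (fun n => Real.sign (y n) * |y n| ^ (s - 1)) z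
  have hs0 : 0 < s := by linarith
  have h1 : lpOn S s.conjExponent (fun n => Real.sign (y n) * |y n| ^ (s - 1)) = 1 := by
    have hsum := lpOn_rpow (S := S) hs0 y
    rw [hy, Real.one_rpow] at hsum
    have : (s - 1) * s.conjExponent = s := by
      rw [Real.conjExponent, mul_div_cancel₀ _ (by linarith : s - 1 ≠ 0)]
    unfold lpOn
    simp_rw [abs_sign_mul_rpow (by linarith : s - 1 ≠ 0), ← Real.rpow_mul (abs_nonneg _), this]
    rw [← hsum, Real.one_rpow]
  rwa [h1, one_mul] at h

/-- A functional with quasi-linearity constant `C` that is within `D` of a linear functional on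
`ℓ_s`, `1 < s ≤ 2`, is within `(1 - t / 8) * D` of another one, provided `D / C` is large. -/
lemma exists_linear_approx_contraction {s t : ℝ} (hs1 : 1 < s) (hs2 : s ≤ 2) (ht0 : 0 < t)
    (ht1 : t ≤ 1) (ht : 32 * t ^ (s - 1) ≤ 1) {S : Finset ℕ} {C D : ℝ} (hC : 0 < C)
    {F : (ℕ → ℝ) → ℝ} (hF : ∀ (c : ℝ) g, F (fun n => c * g n) = c * F g)
    (hFadd : ∀ g h, |F (fun n => g n + h n) - F g - F h| ≤ C * (lpOn S s g + lpOn S s h))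
    (hD : 28 / t * C ≤ D) {ξ : ℕ → ℝ}
    (hξ : ∀ g, |F g - ∑ n ∈ S, ξ n * g n| ≤ D * lpOn S s g) :
    ∃ ξ' : ℕ → ℝ, ∀ g, |F g - ∑ n ∈ S, ξ' n * g n| ≤ (1 - t / 8) * D * lpOn S s g := by
  have hs0 : 0 < s := by linarith
  have hD0 : 0 < D := lt_of_lt_of_le (by positivity) hD
  set G : (ℕ → ℝ) → ℝ := fun g => F g - ∑ n ∈ S, ξ n * g n with hGdef
  have hG : ∀ (c : ℝ) g, G (fun n => c * g n) = c * G g := fun c g => by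
    simp only [hGdef, hF, mul_sub, Finset.mul_sum]
    congr 1; exact Finset.sum_congr rfl fun n _ => by ring
  have hGadd : ∀ g h, |G (fun n => g n + h n) - G g - G h| ≤ C * (lpOn S s g + lpOn S s h) :=
    fun g h => by
      convert hFadd g h using 2
      simp only [hGdef, mul_add, Finset.sum_add_distrib]
      ring
  by_cases hbig : ∃ y, (1 - t / 8) * D * lpOn S s y < |G y|
  swap
  · push Not at hbig
    exact ⟨ξ, hbig⟩
  obtain ⟨y₀, hy₀, hGy₀⟩ : ∃ y, lpOn S s y = 1 ∧ (1 - t / 8) * D < G y := by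
    obtain ⟨y, hy⟩ := hbig
    have hN : 0 < lpOn S s y := by
      refine (lpOn_nonneg _ _ _).lt_of_ne fun h0 => ?_
      have := hξ y
      rw [← h0, mul_zero] at this hy
      exact absurd hy (not_lt.2 this)
    obtain ⟨σ, hσ, hσG⟩ : ∃ σ : ℝ, |σ| = 1 ∧ σ * G y = |G y| := by
      rcases abs_cases (G y) with h | h
      · exact ⟨1, by simp, by rw [h.1, one_mul]⟩
      · exact ⟨-1, by simp, by rw [h.1]; ring⟩
    refine ⟨fun n => (σ / lpOn S s y) * y n, ?_, ?_⟩
    · rw [lpOn_const_mul hs0, abs_div, hσ, abs_of_pos hN, one_div_mul_cancel hN.ne']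
    · rw [hG, div_mul_eq_mul_div, hσG, lt_div_iff₀ hN]
      exact hy
  set J : ℕ → ℝ := fun n => Real.sign (y₀ n) * |y₀ n| ^ (s - 1) with hJ
  have hJy₀ : ∑ n ∈ S, J n * y₀ n = 1 := by
    simp only [hJ, sign_mul_rpow_mul_self hs0]
    rw [← lpOn_rpow hs0, hy₀, Real.one_rpow]
  have hJle : ∀ z, |∑ n ∈ S, J n * z n| ≤ lpOn S s z := abs_sum_duality_le hs1 hy₀
  have hker1 : ∀ z, ∑ n ∈ S, J n * z n = 0 → lpOn S s z = 1 → G z ≤ D / 4 + 2 * C / t := by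
    intro z hz hz1
    have hz2 : ∑ n ∈ S, J n * (t * z n) = 0 := by
      calc ∑ n ∈ S, J n * (t * z n) = t * ∑ n ∈ S, J n * z n := by
            rw [Finset.mul_sum]; exact Finset.sum_congr rfl fun n _ => by ring
        _ = 0 := by rw [hz, mul_zero]
    have h1 := lpOn_add_le_of_sum_eq_zero hs1.le hs2 hy₀ hz2
    have h2 := (abs_le.1 (hGadd y₀ (fun n => t * z n))).1
    have h3 := (abs_le.1 (hξ (fun n => y₀ n + t * z n))).2
    rw [lpOn_const_mul hs0, hz1, abs_of_pos ht0, mul_one] at h1 h2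
    rw [hG, hy₀] at h2
    have h4 := h3.trans (mul_le_mul_of_nonneg_left h1 hD0.le)
    have h5 : t ^ s = t ^ (s - 1) * t := by
      rw [← Real.rpow_add_one ht0.ne']; congr 1; ring
    have h6 : 4 * t ^ s ≤ t / 8 := by rw [h5]; nlinarith
    have h7 : t * G z ≤ t * (D / 4 + 2 * C / t) := by
      have : t * (D / 4 + 2 * C / t) = t * D / 4 + 2 * C := by field_simp
      rw [this]
      change G (fun n => y₀ n + t * z n) ≤ _ at h4
      nlinarith [mul_le_mul_of_nonneg_left h6 hD0.le]
    exact le_of_mul_le_mul_left h7 ht0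
  have hker : ∀ z, ∑ n ∈ S, J n * z n = 0 → |G z| ≤ (D / 4 + 2 * C / t) * lpOn S s z := by
    intro z hz
    rcases (lpOn_nonneg S s z).eq_or_lt with h0 | h0
    · have := hξ z
      rw [← h0, mul_zero] at this ⊢
      exact this
    · have aux : ∀ c : ℝ, |c| = 1 / lpOn S s z → c * G z ≤ D / 4 + 2 * C / t := fun c hc => by
        rw [← hG]
        refine hker1 _ ?_ ?_
        · calc ∑ n ∈ S, J n * (c * z n) = c * ∑ n ∈ S, J n * z n := by
                rw [Finset.mul_sum]; exact Finset.sum_congr rfl fun n _ => by ring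
            _ = 0 := by rw [hz, mul_zero]
        · rw [lpOn_const_mul hs0, hc, one_div_mul_cancel h0.ne']
      have a1 := aux (1 / lpOn S s z) (abs_of_pos (by positivity))
      have a2 := aux (-(1 / lpOn S s z)) (by rw [abs_neg]; exact abs_of_pos (by positivity))
      rw [neg_mul] at a2
      rw [one_div, inv_mul_eq_div] at a1 a2
      rw [← neg_div, div_le_iff₀ h0] at a2
      rw [div_le_iff₀ h0] at a1
      exact abs_le.2 ⟨by linarith, a1⟩
  refine ⟨fun n => ξ n + D * J n, fun g => ?_⟩
  set a : ℝ := ∑ n ∈ S, J n * g n with ha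
  set z : ℕ → ℝ := fun n => g n - a * y₀ n with hzdef
  have hz : ∑ n ∈ S, J n * z n = 0 := by
    calc ∑ n ∈ S, J n * z n = a - a * ∑ n ∈ S, J n * y₀ n := by
          rw [ha, Finset.mul_sum, ← Finset.sum_sub_distrib]
          exact Finset.sum_congr rfl fun n _ => by simp only [hzdef]; ring
      _ = 0 := by rw [hJy₀]; ring
  have haN : |a| ≤ lpOn S s g := hJle g
  have hNa : lpOn S s (fun n => a * y₀ n) = |a| := by rw [lpOn_const_mul hs0, hy₀, mul_one]
  have hNz : lpOn S s z ≤ 2 * lpOn S s g := by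
    have := lpOn_sub_le (S := S) hs1.le g (fun n => a * y₀ n)
    rw [hNa] at this
    linarith
  have h1 := hGadd (fun n => a * y₀ n) z
  have h2 : (fun n => a * y₀ n + z n) = g := by funext n; simp [hzdef]
  rw [h2, hG, hNa] at h1
  have h3 := hker z hz
  have h4 : |a * (G y₀ - D)| ≤ |a| * (t / 8 * D) := by
    rw [abs_mul]
    refine mul_le_mul_of_nonneg_left ?_ (abs_nonneg _)
    have := (abs_le.1 (hξ y₀)).2
    rw [hy₀, mul_one] at this
    change G y₀ ≤ D at this
    rw [abs_le]; constructor <;> nlinarith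
  have h5 : F g - ∑ n ∈ S, (ξ n + D * J n) * g n
      = (G g - a * G y₀ - G z) + (a * (G y₀ - D) + G z) := by
    have : ∑ n ∈ S, (ξ n + D * J n) * g n = ∑ n ∈ S, ξ n * g n + D * a := by
      rw [ha, Finset.mul_sum, ← Finset.sum_add_distrib]
      exact Finset.sum_congr rfl fun n _ => by ring
    rw [this]; simp only [hGdef]; ring
  have hCt : C ≤ C / t := by rw [le_div_iff₀ ht0]; nlinarith
  have hCD : 28 * (C / t) ≤ D := by
    calc 28 * (C / t) = 28 / t * C := by ring
      _ ≤ D := hD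
  rw [h5]
  have hN0 := lpOn_nonneg S s g
  calc |(G g - a * G y₀ - G z) + (a * (G y₀ - D) + G z)|
      ≤ |G g - a * G y₀ - G z| + (|a * (G y₀ - D)| + |G z|) :=
        (abs_add_le _ _).trans (add_le_add_right (abs_add_le _ _) _)
    _ ≤ C * (|a| + lpOn S s z) + (|a| * (t / 8 * D) + (D / 4 + 2 * C / t) * lpOn S s z) := by
        gcongr
    _ ≤ C * (lpOn S s g + 2 * lpOn S s g) + (lpOn S s g * (t / 8 * D)
          + (D / 4 + 2 * C / t) * (2 * lpOn S s g)) := by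
        gcongr
    _ = (3 * C + t / 8 * D + D / 2 + 4 * (C / t)) * lpOn S s g := by ring
    _ ≤ (1 - t / 8) * D * lpOn S s g := by
        refine mul_le_mul_of_nonneg_right ?_ hN0
        nlinarith

/-- Quasi-linear functionals on `ℓ_s`, `1 < s ≤ 2`, are uniformly close to linear functionals. -/
lemma exists_linear_approx {s : ℝ} (hs1 : 1 < s) (hs2 : s ≤ 2) :
    ∃ K : ℝ, 0 < K ∧ ∀ (S : Finset ℕ) (C D : ℝ) (F : (ℕ → ℝ) → ℝ), 0 < C →
      (∀ (c : ℝ) g, F (fun n => c * g n) = c * F g) →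
      (∀ g h, |F (fun n => g n + h n) - F g - F h| ≤ C * (lpOn S s g + lpOn S s h)) →
      (∀ g, |F g| ≤ D * lpOn S s g) →
      ∃ ξ : ℕ → ℝ, ∀ g, |F g - ∑ n ∈ S, ξ n * g n| ≤ K * C * lpOn S s g := by
  obtain ⟨t, ht0, ht1, ht⟩ : ∃ t : ℝ, 0 < t ∧ t ≤ 1 ∧ 32 * t ^ (s - 1) ≤ 1 := by
    refine ⟨(1 / 32) ^ (1 / (s - 1)), by positivity,
      Real.rpow_le_one (by norm_num) (by norm_num) (by
        have : 0 < s - 1 := by linarith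
        positivity), ?_⟩
    rw [← Real.rpow_mul (by norm_num), one_div_mul_cancel (by linarith), Real.rpow_one]
    norm_num
  refine ⟨28 / t, by positivity, fun S C D F hC hF hFadd hD => ?_⟩
  have happrox_pow : ∀ k : ℕ, ∃ ξ : ℕ → ℝ, ∀ g, |F g - ∑ n ∈ S, ξ n * g n| ≤
      max ((1 - t / 8) ^ k * D) (28 / t * C) * lpOn S s g := by
    intro k
    induction k with
    | zero =>
      refine ⟨0, fun g => ?_⟩
      simp only [Pi.zero_apply, zero_mul, Finset.sum_const_zero, sub_zero, pow_zero, one_mul]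
      exact (hD g).trans (mul_le_mul_of_nonneg_right (le_max_left _ _) (lpOn_nonneg _ _ _))
    | succ k ih =>
      obtain ⟨ξ, hξ⟩ := ih
      rcases le_total ((1 - t / 8) ^ k * D) (28 / t * C) with h | h
      · rw [max_eq_right h] at hξ
        exact ⟨ξ, fun g => (hξ g).trans
          (mul_le_mul_of_nonneg_right (le_max_right _ _) (lpOn_nonneg _ _ _))⟩
      · rw [max_eq_left h] at hξ
        obtain ⟨ξ', hξ'⟩ :=
          exists_linear_approx_contraction hs1 hs2 ht0 ht1 ht hC hF hFadd h hξ
        refine ⟨ξ', fun g => (hξ' g).trans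
          (mul_le_mul_of_nonneg_right (le_max_of_le_left ?_) (lpOn_nonneg _ _ _))⟩
        rw [pow_succ']
        linarith
  obtain ⟨k, hk⟩ : ∃ k : ℕ, (1 - t / 8) ^ k * D ≤ 28 / t * C := by
    have h1 : Filter.Tendsto (fun k : ℕ => (1 - t / 8) ^ k * D) Filter.atTop (nhds (0 * D)) :=
      (tendsto_pow_atTop_nhds_zero_of_lt_one (by linarith) (by linarith)).mul_const D
    rw [zero_mul] at h1
    exact ((h1.eventually_lt_const (by positivity : 0 < 28 / t * C)).exists).imp fun _ h => h.le
  obtain ⟨ξ, hξ⟩ := happrox_pow k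
  rw [max_eq_right hk] at hξ
  exact ⟨ξ, hξ⟩

lemma finSupp_of_forall_notMem {S : Finset ℕ} {x : ℕ → ℝ} (h : ∀ n ∉ S, x n = 0) : FinSupp x :=
  S.finite_toSet.subset fun n hn => by
    by_contra hnS
    exact hn (h n hnS)

/-- Homogeneous support-preserving centralizers on `ℓ_p`, with all norms computed as finite
sums. -/
structure IsCentralizer (p C : ℝ) (Φ : (ℕ → ℝ) → (ℕ → ℝ)) : Prop where
  homog : ∀ (c : ℝ) (x : ℕ → ℝ), FinSupp x → Φ (fun n => c * x n) = fun n => c * Φ x n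
  supp : ∀ x : ℕ → ℝ, FinSupp x → ∀ n, x n = 0 → Φ x n = 0
  cent : ∀ (S : Finset ℕ) (a x : ℕ → ℝ), (∀ n ∉ S, x n = 0) → (∀ n, |a n| ≤ 1) →
    lpOn S p (fun n => Φ (fun m => a m * x m) n - a n * Φ x n) ≤ C * lpOn S p x

/-- The functional `h ↦ ⟨w, Φ z⟩`, where `h = w z` is the Lozanovskii factorization
`w = sgn(h) |h|^(1 - 1/p)`, `z = |h|^(1/p)` of `ℓ_1` through `ℓ_p`. -/
noncomputable def centralizerFunctional (S : Finset ℕ) (p : ℝ) (Φ : (ℕ → ℝ) → (ℕ → ℝ))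
    (h : ℕ → ℝ) : ℝ :=
  ∑ n ∈ S, Real.sign (h n) * |h n| ^ (1 - 1 / p) * Φ (fun k => |h k| ^ (1 / p)) n

lemma abs_sign_le_one (r : ℝ) : |Real.sign r| ≤ 1 := by
  rcases Real.sign_apply_eq r with h | h | h <;> simp [h]

lemma sign_mul' (a b : ℝ) : Real.sign (a * b) = Real.sign a * Real.sign b := by
  rcases lt_trichotomy a 0 with ha | rfl | ha <;> rcases lt_trichotomy b 0 with hb | rfl | hb <;>
    simp [Real.sign_of_neg, Real.sign_of_pos, mul_pos_of_neg_of_neg, mul_neg_of_neg_of_pos,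
      mul_neg_of_pos_of_neg, *]

lemma sign_mul_abs' (a : ℝ) : Real.sign a * |a| = a := by
  rcases lt_trichotomy a 0 with ha | rfl | ha <;>
    simp [Real.sign_of_neg, Real.sign_of_pos, abs_of_neg, abs_of_pos, *]

namespace IsCentralizer

variable {p C : ℝ} {Φ : (ℕ → ℝ) → (ℕ → ℝ)}

lemma abs_sum_sub_sum_le (hΦ : IsCentralizer p C Φ) (hp : 1 ≤ p) (hC : 0 < C) {S : Finset ℕ}
    {m α β : ℕ → ℝ} {M : ℝ} (hm : ∀ n, 0 ≤ m n) (hmS : ∀ n ∉ S, m n = 0)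
    (hM : ∑ n ∈ S, m n ≤ M) (hα : ∀ n, |α n| ≤ 1) (hβ : ∀ n, |β n| ≤ 1) :
    |∑ n ∈ S, β n * m n ^ (1 - 1 / p) * Φ (fun k => α k * m k ^ (1 / p)) n
      - ∑ n ∈ S, α n * β n * m n ^ (1 - 1 / p) * Φ (fun k => m k ^ (1 / p)) n| ≤ C * M := by
  have hp0 : 0 < p := by linarith
  have hc := hΦ.cent S α (fun k => m k ^ (1 / p)) (fun n hn => by
    rw [hmS n hn, Real.zero_rpow (by positivity)]) hα
  have hN : lpOn S p (fun k => m k ^ (1 / p)) ≤ M ^ (1 / p) := by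
    unfold lpOn
    refine Real.rpow_le_rpow (sum_abs_rpow_nonneg _ _ _) (le_trans (le_of_eq ?_) hM)
      (by positivity)
    refine Finset.sum_congr rfl fun n _ => ?_
    rw [abs_of_nonneg (Real.rpow_nonneg (hm n) _), ← Real.rpow_mul (hm n),
      one_div_mul_cancel hp0.ne', Real.rpow_one]
  have h := sum_rpow_mul_le hp hC (fun n _ => hm n) hM
    (hc.trans (mul_le_mul_of_nonneg_left hN hC.le))
  rw [← Finset.sum_sub_distrib]
  refine (Finset.abs_sum_le_sum_abs _ _).trans (le_trans (Finset.sum_le_sum fun n _ => ?_) h)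
  have e : β n * m n ^ (1 - 1 / p) * Φ (fun k => α k * m k ^ (1 / p)) n
      - α n * β n * m n ^ (1 - 1 / p) * Φ (fun k => m k ^ (1 / p)) n
      = β n * (m n ^ (1 - 1 / p) *
        (Φ (fun k => α k * m k ^ (1 / p)) n - α n * Φ (fun k => m k ^ (1 / p)) n)) := by ring
  rw [e, abs_mul, abs_mul, abs_of_nonneg (Real.rpow_nonneg (hm n) _)]
  exact mul_le_of_le_one_left
    (mul_nonneg (Real.rpow_nonneg (hm n) _) (abs_nonneg _)) (hβ n)

lemma abs_functional_sub_sum_le (hΦ : IsCentralizer p C Φ) (hp : 1 ≤ p) (hC : 0 < C)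
    {S : Finset ℕ} {m a : ℕ → ℝ} {M : ℝ} (hm : ∀ n, 0 ≤ m n) (hmS : ∀ n ∉ S, m n = 0)
    (hM : ∑ n ∈ S, m n ≤ M) (ha : ∀ n, |a n| ≤ 1) :
    |centralizerFunctional S p Φ (fun n => a n * m n)
      - ∑ n ∈ S, a n * m n ^ (1 - 1 / p) * Φ (fun k => m k ^ (1 / p)) n| ≤ C * M := by
  have hp0 : 0 < p := by linarith
  have h1p : 0 ≤ 1 - 1 / p := by rw [sub_nonneg, div_le_one hp0]; exact hp
  have h1p0 : 0 ≤ 1 / p := by positivity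
  have h := hΦ.abs_sum_sub_sum_le hp hC hm hmS hM (α := fun n => |a n| ^ (1 / p))
    (β := fun n => Real.sign (a n) * |a n| ^ (1 - 1 / p))
    (fun n => by
      rw [abs_of_nonneg (Real.rpow_nonneg (abs_nonneg _) _)]
      exact Real.rpow_le_one (abs_nonneg _) (ha n) h1p0)
    (fun n => by
      rw [abs_mul, abs_of_nonneg (Real.rpow_nonneg (abs_nonneg _) _)]
      exact mul_le_one₀ (abs_sign_le_one _) (Real.rpow_nonneg (abs_nonneg _) _)
        (Real.rpow_le_one (abs_nonneg _) (ha n) h1p))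
  have hz : (fun k => |a k * m k| ^ (1 / p)) = fun k => |a k| ^ (1 / p) * m k ^ (1 / p) := by
    funext k
    rw [abs_mul, abs_of_nonneg (hm k), Real.mul_rpow (abs_nonneg _) (hm k)]
  convert h using 3
  · unfold centralizerFunctional
    refine Finset.sum_congr rfl fun n _ => ?_
    rw [hz]
    rcases (hm n).eq_or_lt with h0 | h0
    · rw [hΦ.supp _ (finSupp_of_forall_notMem (S := S) fun k hk => by
        rw [hmS k hk, Real.zero_rpow (by positivity), mul_zero]) n (by
        rw [← h0, Real.zero_rpow (by positivity), mul_zero]), mul_zero, mul_zero]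
    · rw [sign_mul', Real.sign_of_pos h0, abs_mul, abs_of_pos h0,
        Real.mul_rpow (abs_nonneg _) h0.le]
      ring
  · refine Finset.sum_congr rfl fun n _ => ?_
    have h1 : |a n| ^ (1 / p) * |a n| ^ (1 - 1 / p) = |a n| := by
      rw [← Real.rpow_add_of_nonneg (abs_nonneg _) h1p0 h1p, add_sub_cancel, Real.rpow_one]
    have h2 : a n = |a n| ^ (1 / p) * (Real.sign (a n) * |a n| ^ (1 - 1 / p)) := by
      rw [mul_left_comm, h1, sign_mul_abs']
    rw [← h2]

lemma functional_const_mul (hΦ : IsCentralizer p C Φ) (hp : 1 ≤ p) {S : Finset ℕ}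
    {h : ℕ → ℝ} (hS : ∀ n ∉ S, h n = 0) (c : ℝ) :
    centralizerFunctional S p Φ (fun n => c * h n) = c * centralizerFunctional S p Φ h := by
  have hp0 : 0 < p := by linarith
  have h1p : 0 ≤ 1 - 1 / p := by rw [sub_nonneg, div_le_one hp0]; exact hp
  have h1p0 : 0 ≤ 1 / p := by positivity
  have hz : (fun k => |c * h k| ^ (1 / p)) = fun k => |c| ^ (1 / p) * |h k| ^ (1 / p) := by
    funext k
    rw [abs_mul, Real.mul_rpow (abs_nonneg _) (abs_nonneg _)]
  have hc : |c| ^ (1 / p) * |c| ^ (1 - 1 / p) = |c| := by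
    rw [← Real.rpow_add_of_nonneg (abs_nonneg _) h1p0 h1p, add_sub_cancel, Real.rpow_one]
  unfold centralizerFunctional
  rw [hz, hΦ.homog _ _ (finSupp_of_forall_notMem (S := S) fun k hk => by
        rw [hS k hk, abs_zero, Real.zero_rpow (by positivity)]), Finset.mul_sum]
  refine Finset.sum_congr rfl fun n _ => ?_
  rw [sign_mul', abs_mul, Real.mul_rpow (abs_nonneg _) (abs_nonneg _)]
  calc _ = (Real.sign c * (|c| ^ (1 / p) * |c| ^ (1 - 1 / p))) * (Real.sign (h n) *
        |h n| ^ (1 - 1 / p) * Φ (fun k => |h k| ^ (1 / p)) n) := by ring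
    _ = _ := by rw [hc, sign_mul_abs']

lemma functional_add (hΦ : IsCentralizer p C Φ) (hp : 1 ≤ p) (hC : 0 < C) {S : Finset ℕ}
    {g h : ℕ → ℝ} (hg : ∀ n ∉ S, g n = 0) (hh : ∀ n ∉ S, h n = 0) :
    |centralizerFunctional S p Φ (fun n => g n + h n) - centralizerFunctional S p Φ g
      - centralizerFunctional S p Φ h| ≤ 3 * C * ∑ n ∈ S, (|g n| + |h n|) := by
  set m : ℕ → ℝ := fun n => |g n| + |h n| with hmdef
  have hm : ∀ n, 0 ≤ m n := fun n => by positivity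
  have hmS : ∀ n ∉ S, m n = 0 := fun n hn => by simp [hmdef, hg n hn, hh n hn]
  have key : ∀ f : ℕ → ℝ, (∀ n, |f n| ≤ m n) →
      |centralizerFunctional S p Φ f
        - ∑ n ∈ S, f n / m n * m n ^ (1 - 1 / p) * Φ (fun k => m k ^ (1 / p)) n|
        ≤ C * ∑ n ∈ S, m n := by
    intro f hf
    have := hΦ.abs_functional_sub_sum_le hp hC hm hmS le_rfl (a := fun n => f n / m n)
      (fun n => by
        rw [abs_div, abs_of_nonneg (hm n)]
        exact div_le_one_of_le₀ (hf n) (hm n))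
    have e : (fun n => f n / m n * m n) = f := by
      funext n
      refine div_mul_cancel_of_imp fun h0 => ?_
      have := hf n
      rw [h0] at this
      exact abs_nonpos_iff.1 this
    rwa [e] at this
  have k1 := key (fun n => g n + h n) fun n => abs_add_le _ _
  have k2 := key g fun n => by simp [hmdef]
  have k3 := key h fun n => by simp [hmdef]
  have e : ∑ n ∈ S, (g n + h n) / m n * m n ^ (1 - 1 / p) * Φ (fun k => m k ^ (1 / p)) n
      = ∑ n ∈ S, g n / m n * m n ^ (1 - 1 / p) * Φ (fun k => m k ^ (1 / p)) n
        + ∑ n ∈ S, h n / m n * m n ^ (1 - 1 / p) * Φ (fun k => m k ^ (1 / p)) n := by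
    rw [← Finset.sum_add_distrib]
    exact Finset.sum_congr rfl fun n _ => by ring
  rw [e] at k1
  rw [abs_le] at *
  constructor <;> linarith [k1.1, k1.2, k2.1, k2.2, k3.1, k3.2]

lemma abs_sum_mul_sub_functional_le (hΦ : IsCentralizer p C Φ) (hp : 1 ≤ p) (hC : 0 < C)
    {S : Finset ℕ} {w z ω : ℕ → ℝ} {M : ℝ} (hz : ∀ n ∉ S, z n = 0) (hω : ∀ n, 0 ≤ ω n)
    (hωS : ∀ n ∉ S, ω n = 0) (hw : ∀ n, |w n| ≤ ω n ^ (1 - 1 / p))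
    (hzM : ∑ n ∈ S, |z n| ^ p ≤ M) (hωM : ∑ n ∈ S, ω n ≤ M) :
    |∑ n ∈ S, w n * Φ z n - centralizerFunctional S p Φ (fun n => w n * z n)|
      ≤ 4 * C * M := by
  have hp0 : 0 < p := by linarith
  have h1p : 0 ≤ 1 - 1 / p := by rw [sub_nonneg, div_le_one hp0]; exact hp
  have h1p0 : 0 ≤ 1 / p := by positivity
  set m : ℕ → ℝ := fun n => |z n| ^ p + ω n with hmdef
  have hzp : ∀ n, 0 ≤ |z n| ^ p := fun n => Real.rpow_nonneg (abs_nonneg _) _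
  have hm : ∀ n, 0 ≤ m n := fun n => add_nonneg (hzp n) (hω n)
  have hmS : ∀ n ∉ S, m n = 0 := fun n hn => by
    simp [hmdef, hz n hn, hωS n hn, Real.zero_rpow hp0.ne']
  have hM : ∑ n ∈ S, m n ≤ 2 * M := by
    rw [hmdef, Finset.sum_add_distrib]; linarith
  have hzm : ∀ n, |z n| ≤ m n ^ (1 / p) := fun n => by
    calc |z n| = (|z n| ^ p) ^ (1 / p) := by
          rw [← Real.rpow_mul (abs_nonneg _), mul_one_div_cancel hp0.ne', Real.rpow_one]
      _ ≤ _ := Real.rpow_le_rpow (hzp n) (by simp [hmdef, hω n]) h1p0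
  have hwm : ∀ n, |w n| ≤ m n ^ (1 - 1 / p) := fun n =>
    (hw n).trans (Real.rpow_le_rpow (hω n) (by simp [hmdef, hzp n]) h1p)
  have bound : ∀ {a b : ℝ}, |a| ≤ b → |a / b| ≤ 1 := fun {a b} hab => by
    have hb : 0 ≤ b := (abs_nonneg _).trans hab
    rw [abs_div, abs_of_nonneg hb]
    exact div_le_one_of_le₀ hab hb
  have cancel : ∀ {a b : ℝ}, |a| ≤ b → a / b * b = a := fun {a b} hab =>
    div_mul_cancel_of_imp fun h0 => abs_nonpos_iff.1 (hab.trans h0.le)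
  set α : ℕ → ℝ := fun n => z n / m n ^ (1 / p) with hα
  set β : ℕ → ℝ := fun n => w n / m n ^ (1 - 1 / p) with hβ
  have hα1 : ∀ n, |α n| ≤ 1 := fun n => bound (hzm n)
  have hβ1 : ∀ n, |β n| ≤ 1 := fun n => bound (hwm n)
  have k1 := hΦ.abs_sum_sub_sum_le hp hC hm hmS hM hα1 hβ1
  have k2 := hΦ.abs_functional_sub_sum_le hp hC hm hmS hM (a := fun n => α n * β n)
    (fun n => by
      rw [abs_mul]
      exact mul_le_one₀ (hα1 n) (abs_nonneg _) (hβ1 n))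
  have e1 : (fun k => α k * m k ^ (1 / p)) = z := funext fun n => cancel (hzm n)
  have e2 : ∀ n, β n * m n ^ (1 - 1 / p) = w n := fun n => cancel (hwm n)
  have e3 : (fun n => α n * β n * m n) = fun n => w n * z n := by
    funext n
    calc α n * β n * m n = (β n * m n ^ (1 - 1 / p)) * (α n * m n ^ (1 / p)) := by
          have : m n = m n ^ (1 / p) * m n ^ (1 - 1 / p) := by
            rw [← Real.rpow_add_of_nonneg (hm n) h1p0 h1p, add_sub_cancel, Real.rpow_one]
          nth_rewrite 1 [this]
          ring
      _ = _ := by rw [e2, congrFun e1 n]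
  simp_rw [e1, e2] at k1
  rw [e3] at k2
  rw [abs_le] at *
  constructor <;> linarith [k1.1, k1.2, k2.1, k2.2]

end IsCentralizer

/-- A quasi-linear functional of finitely many coordinates is bounded. -/
lemma exists_bound_of_quasilinear {s : ℝ} (hs : 0 < s) {S : Finset ℕ} {C : ℝ} (hC : 0 ≤ C)
    {F : (ℕ → ℝ) → ℝ} (hF : ∀ (c : ℝ) g, F (fun n => c * g n) = c * F g)
    (hFadd : ∀ g h, |F (fun n => g n + h n) - F g - F h| ≤ C * (lpOn S s g + lpOn S s h))
    (hFS : ∀ g, F (fun n => if n ∈ S then g n else 0) = F g) :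
    ∃ D : ℝ, ∀ g, |F g| ≤ D * lpOn S s g := by
  have key : ∀ T : Finset ℕ, T ⊆ S →
      ∃ D : ℝ, ∀ g, |F (fun n => if n ∈ T then g n else 0)| ≤ D * lpOn S s g := by
    intro T
    induction T using Finset.induction_on with
    | empty =>
      intro _
      refine ⟨0, fun g => ?_⟩
      have := hF 0 0
      simp only [zero_mul] at this
      simp [this]
    | insert k T hk ih =>
      intro hT
      obtain ⟨D, hD⟩ := ih fun n hn => hT (Finset.mem_insert_of_mem hn)
      set e : ℕ → ℝ := fun n => if n = k then 1 else 0 with he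
      refine ⟨D + |F e| + C * (1 + lpOn S s e), fun g => ?_⟩
      have hgk : |g k| ≤ lpOn S s g := abs_le_lpOn hs g (hT (Finset.mem_insert_self _ _))
      have h1 := hFadd (fun n => if n ∈ T then g n else 0) (fun n => g k * e n)
      have h2 : (fun n => (if n ∈ T then g n else 0) + g k * e n)
          = fun n => if n ∈ insert k T then g n else 0 := by
        funext n
        by_cases hn : n = k
        · subst hn; simp [he, hk]
        · simp [he, hn]
      have h3 : lpOn S s (fun n => if n ∈ T then g n else 0) ≤ lpOn S s g :=
        lpOn_mono hs fun n _ => by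
          by_cases hn : n ∈ T <;> simp [hn]
      rw [h2, hF, lpOn_const_mul hs] at h1
      have h4 : |g k * F e| ≤ lpOn S s g * |F e| := by
        rw [abs_mul]
        exact mul_le_mul_of_nonneg_right hgk (abs_nonneg _)
      have h5 : |g k| * lpOn S s e ≤ lpOn S s g * lpOn S s e :=
        mul_le_mul_of_nonneg_right hgk (lpOn_nonneg _ _ _)
      have h6 := hD g
      have h7 : C * (lpOn S s (fun n => if n ∈ T then g n else 0) + |g k| * lpOn S s e)
          ≤ C * (lpOn S s g + lpOn S s g * lpOn S s e) :=
        mul_le_mul_of_nonneg_left (add_le_add h3 h5) hC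
      rw [abs_le] at *
      constructor <;> linarith [h1.1, h1.2, h4.1, h4.2, h6.1, h6.2]
  obtain ⟨D, hD⟩ := key S subset_rfl
  exact ⟨D, fun g => hFS g ▸ hD g⟩

namespace IsCentralizer

variable {p C : ℝ} {Φ : (ℕ → ℝ) → (ℕ → ℝ)}

/-- If `ξ` represents the functional of the centralizer along `u` in `ℓ_s`,
`1/s + 1/(2 p) = 1`, then multiplication by `ξ` approximates `y ↦ Φ (u y)`. -/
lemma lpOn_mul_sub_le_of_functional (hΦ : IsCentralizer p C Φ) (hp : 1 ≤ p) (hC : 0 < C)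
    {K : ℝ} (hK : 0 ≤ K) {S : Finset ℕ} {u ξ y : ℕ → ℝ} (huS : ∀ n ∉ S, u n = 0)
    (hu : lpOn S (2 * p) u ≤ 1)
    (hξ : ∀ g, |centralizerFunctional S p Φ (fun n => u n * g n) - ∑ n ∈ S, ξ n * g n|
      ≤ K * lpOn S (2 * p).conjExponent g)
    (hyS : ∀ n ∉ S, y n = 0) (hy : lpOn S (2 * p) y ≤ 1) :
    lpOn S p (fun n => ξ n * y n - Φ (fun k => u k * y k) n) ≤ K + 4 * C := by
  have hp0 : 0 < p := by linarith
  have h2p : (2 * p).HolderConjugate (2 * p).conjExponent :=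
    Real.HolderConjugate.conjExponent (by linarith)
  set R : ℕ → ℝ := fun n => ξ n * y n - Φ (fun k => u k * y k) n with hR
  have huyS : ∀ n ∉ S, u n * y n = 0 := fun n hn => by rw [huS n hn, zero_mul]
  have hRS : ∀ n ∉ S, R n = 0 := fun n hn => by
    simp only [hR]
    rw [hyS n hn, hΦ.supp _ (finSupp_of_forall_notMem huyS) n (huyS n hn)]
    ring
  set ρ := lpOn S p R with hρ
  rcases (lpOn_nonneg S p R).eq_or_lt with h0 | hρ0
  · rw [hρ, ← h0]; positivity
  rw [← hρ] at hρ0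
  have hRρ : ∀ n, 0 ≤ |R n| / ρ := fun n => by positivity
  set ω : ℕ → ℝ := fun n => (|R n| / ρ) ^ p with hω
  set w : ℕ → ℝ := fun n => Real.sign (R n) * (|R n| / ρ) ^ (p - 1) with hw
  have hω0 : ∀ n, 0 ≤ ω n := fun n => Real.rpow_nonneg (hRρ n) _
  have hωS : ∀ n ∉ S, ω n = 0 := fun n hn => by
    simp [hω, hRS n hn, Real.zero_rpow hp0.ne']
  have hωsum : ∑ n ∈ S, ω n = 1 := by
    simp only [hω, Real.div_rpow (abs_nonneg _) hρ0.le]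
    rw [← Finset.sum_div, ← lpOn_rpow hp0, ← hρ, div_self (Real.rpow_pos_of_pos hρ0 _).ne']
  have hwω : ∀ n, |w n| ≤ ω n ^ (1 - 1 / p) := fun n => by
    simp only [hw, hω]
    rw [abs_mul, abs_of_nonneg (Real.rpow_nonneg (hRρ n) _), ← Real.rpow_mul (hRρ n)]
    have : p * (1 - 1 / p) = p - 1 := by field_simp
    rw [this]
    exact mul_le_of_le_one_left (Real.rpow_nonneg (hRρ n) _) (abs_sign_le_one _)
  have hwR : ∑ n ∈ S, w n * R n = ρ := by
    have : ∀ n, w n * R n = ρ * ω n := fun n => by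
      simp only [hw, hω, Real.div_rpow (abs_nonneg _) hρ0.le]
      rw [← sign_mul_rpow_mul_self hp0, Real.rpow_sub_one hρ0.ne']
      field_simp
    simp_rw [this]
    rw [← Finset.mul_sum, hωsum, mul_one]
  have huy : ∑ n ∈ S, |u n * y n| ^ p ≤ 1 := by
    have h := lpOn_mul_le (S := S) hp0 u y
    have h1 : lpOn S p (fun n => u n * y n) ≤ 1 :=
      h.trans (mul_le_one₀ hu (lpOn_nonneg _ _ _) hy)
    rwa [lpOn_le_iff hp0 zero_le_one, Real.one_rpow] at h1
  have hwy : lpOn S (2 * p).conjExponent (fun n => w n * y n) ≤ 1 := by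
    set s := (2 * p).conjExponent with hs
    have hs0 : 0 < s := h2p.symm.pos
    have hys : ∑ n ∈ S, |y n| ^ (2 * p) ≤ 1 := by
      rwa [lpOn_le_iff (by linarith) zero_le_one, Real.one_rpow] at hy
    have hs' : s = 2 * p / (2 * p - 1) := rfl
    have h2p1 : 0 < 2 * p - 1 := by linarith
    rw [lpOn_le_iff hs0 zero_le_one, Real.one_rpow]
    have key : ∀ n ∈ S, |w n * y n| ^ s ≤
        (2 * p - 2) / (2 * p - 1) * ω n + 1 / (2 * p - 1) * |y n| ^ (2 * p) := by
      intro n _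
      have hY := Real.geom_mean_le_arith_mean2_weighted
        (div_nonneg (by linarith : 0 ≤ 2 * p - 2) h2p1.le) (by positivity : 0 ≤ 1 / (2 * p - 1))
        (hω0 n) (Real.rpow_nonneg (abs_nonneg (y n)) (2 * p)) (by field_simp; ring)
      refine le_trans ?_ hY
      rw [abs_mul, Real.mul_rpow (abs_nonneg _) (abs_nonneg _), ← Real.rpow_mul (abs_nonneg _),
        show 2 * p * (1 / (2 * p - 1)) = s by rw [hs']; ring]
      refine mul_le_mul_of_nonneg_right ?_ (Real.rpow_nonneg (abs_nonneg _) _)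
      refine (Real.rpow_le_rpow (abs_nonneg _) (hwω n) hs0.le).trans_eq ?_
      rw [← Real.rpow_mul (hω0 n)]
      congr 1
      rw [hs']
      field_simp
    refine (Finset.sum_le_sum key).trans ?_
    rw [Finset.sum_add_distrib, ← Finset.mul_sum, ← Finset.mul_sum, hωsum]
    calc _ ≤ (2 * p - 2) / (2 * p - 1) * 1 + 1 / (2 * p - 1) * 1 := by gcongr
      _ = 1 := by field_simp; ring
  have k1 := hξ (fun n => w n * y n)
  have k2 := hΦ.abs_sum_mul_sub_functional_le hp hC huyS hω0 hωS hwω huy hωsum.le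
  have e1 : (fun n => u n * (w n * y n)) = fun n => w n * (u n * y n) := by
    funext n; ring
  have e2 : ∑ n ∈ S, w n * R n
      = ∑ n ∈ S, ξ n * (w n * y n) - ∑ n ∈ S, w n * Φ (fun k => u k * y k) n := by
    rw [← Finset.sum_sub_distrib]
    exact Finset.sum_congr rfl fun n _ => by simp only [hR]; ring
  rw [e1] at k1
  have k3 := mul_le_mul_of_nonneg_left hwy hK
  rw [← hwR, e2]
  linarith [(abs_le.1 k1).1, (abs_le.1 k2).1]

/-- Kalton's lifting of a centralizer on `ℓ_p` to `ℓ_{2 p}`, on the unit ball. -/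
lemma exists_lift_of_le_one (hp : 1 ≤ p) : ∃ K : ℝ, 0 < K ∧
    ∀ (C : ℝ) (Φ : (ℕ → ℝ) → (ℕ → ℝ)), IsCentralizer p C Φ → 0 < C →
    ∀ (S : Finset ℕ) (u : ℕ → ℝ), (∀ n ∉ S, u n = 0) → lpOn S (2 * p) u ≤ 1 →
    ∃ ξ : ℕ → ℝ, ∀ y : ℕ → ℝ, (∀ n ∉ S, y n = 0) →
      lpOn S p (fun n => ξ n * y n - Φ (fun k => u k * y k) n) ≤ K * C * lpOn S (2 * p) y := by
  have hp0 : 0 < p := by linarith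
  have h2p0 : 0 < 2 * p := by linarith
  have h2p : (2 * p).HolderConjugate (2 * p).conjExponent :=
    Real.HolderConjugate.conjExponent (by linarith)
  set s := (2 * p).conjExponent with hs
  have hs0 : 0 < s := h2p.symm.pos
  have hs1 : 1 < s := h2p.symm.lt
  have hs2 : s ≤ 2 := by
    rw [hs, Real.conjExponent, div_le_iff₀ (by linarith)]; linarith
  obtain ⟨K, hK, happ⟩ := exists_linear_approx hs1 hs2
  refine ⟨3 * K + 4, by positivity, fun C Φ hΦ hC S u huS hu => ?_⟩
  set F : (ℕ → ℝ) → ℝ := fun g => centralizerFunctional S p Φ (fun n => u n * g n) with hFdef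
  have hugS : ∀ g : ℕ → ℝ, ∀ n ∉ S, u n * g n = 0 := fun g n hn => by rw [huS n hn, zero_mul]
  have hF : ∀ (c : ℝ) g, F (fun n => c * g n) = c * F g := fun c g => by
    simp only [hFdef]
    rw [← hΦ.functional_const_mul hp (hugS g)]
    congr 1; funext n; ring
  have hug : ∀ g : ℕ → ℝ, ∑ n ∈ S, |u n * g n| ≤ lpOn S s g := fun g =>
    (sum_abs_mul_le h2p u g).trans (mul_le_of_le_one_left (lpOn_nonneg _ _ _) hu)
  have hFadd : ∀ g h, |F (fun n => g n + h n) - F g - F h|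
      ≤ 3 * C * (lpOn S s g + lpOn S s h) := fun g h => by
    have := hΦ.functional_add hp hC (hugS g) (hugS h)
    rw [Finset.sum_add_distrib] at this
    simp only [hFdef, mul_add (u _)]
    exact this.trans (mul_le_mul_of_nonneg_left (add_le_add (hug g) (hug h)) (by positivity))
  have hFS : ∀ g, F (fun n => if n ∈ S then g n else 0) = F g := fun g => by
    simp only [hFdef]
    congr 1; funext n
    by_cases hn : n ∈ S
    · rw [if_pos hn]
    · rw [if_neg hn, huS n hn]; ring
  obtain ⟨D, hD⟩ := exists_bound_of_quasilinear hs0 (by positivity) hF hFadd hFS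
  obtain ⟨ξ, hξ⟩ := happ S (3 * C) D F (by positivity) hF hFadd hD
  refine ⟨ξ, fun y hyS => ?_⟩
  rcases (lpOn_nonneg S (2 * p) y).eq_or_lt with h0 | hN
  · have hy0 : ∀ n, y n = 0 := fun n => by
      by_cases hn : n ∈ S
      · exact abs_nonpos_iff.1 (h0 ▸ abs_le_lpOn h2p0 y hn)
      · exact hyS n hn
    rw [← h0, mul_zero]
    refine (lpOn_zero hp0 fun n _ => ?_).le
    rw [hΦ.supp _ (finSupp_of_forall_notMem (hugS y)) n (by rw [hy0, mul_zero]), hy0]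
    ring
  · set N := lpOn S (2 * p) y with hNdef
    have h1 := hΦ.lpOn_mul_sub_le_of_functional hp hC (by positivity) huS hu hξ
      (y := fun n => N⁻¹ * y n) (fun n hn => by rw [hyS n hn, mul_zero])
      (by rw [lpOn_const_mul h2p0, abs_of_pos (by positivity), ← hNdef,
        inv_mul_cancel₀ hN.ne'])
    have e1 : (fun k => u k * (N⁻¹ * y k)) = fun k => N⁻¹ * (u k * y k) := by
      funext k; ring
    have e2 : (fun n => ξ n * (N⁻¹ * y n) - Φ (fun k => u k * (N⁻¹ * y k)) n)
        = fun n => N⁻¹ * (ξ n * y n - Φ (fun k => u k * y k) n) := by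
      funext n
      rw [e1, hΦ.homog _ _ (finSupp_of_forall_notMem (hugS y))]
      ring
    rw [e2, lpOn_const_mul hp0, abs_of_pos (by positivity), inv_mul_le_iff₀ hN] at h1
    refine h1.trans_eq ?_
    ring

end IsCentralizer

lemma pNorm_eq_lpOn {q : ℝ} (hq : 0 < q) {S : Finset ℕ} {f : ℕ → ℝ} (h : ∀ n ∉ S, f n = 0) :
    pNorm q f = lpOn S q f := by
  rw [pNorm, lpOn, tsum_eq_sum fun n hn => by rw [h n hn, abs_zero, Real.zero_rpow hq.ne']]

lemma FinSupp.eq_zero_of_notMem {x : ℕ → ℝ} (hx : FinSupp x) :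
    ∀ n ∉ Set.Finite.toFinset hx, x n = 0 := fun n hn => by
  by_contra h
  exact hn ((Set.Finite.mem_toFinset hx).2 h)

/-- `ξ` is a positively homogeneous support-preserving map on finitely supported sequences
which lifts `Φ` to `ℓ_{2 p}`: `Φ (u y)` is close to `ξ u · y` in `ℓ_p`. -/
structure IsLift (p K : ℝ) (Φ ξ : (ℕ → ℝ) → (ℕ → ℝ)) : Prop where
  homog : ∀ (c : ℝ) (u : ℕ → ℝ), FinSupp u → 0 ≤ c → ξ (fun n => c * u n) = fun n => c * ξ u n
  supp : ∀ u : ℕ → ℝ, FinSupp u → ∀ n, u n = 0 → ξ u n = 0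
  lift : ∀ (S : Finset ℕ) (u y : ℕ → ℝ), (∀ n ∉ S, u n = 0) → (∀ n ∉ S, y n = 0) →
    lpOn S p (fun n => ξ u n * y n - Φ (fun k => u k * y k) n)
      ≤ K * lpOn S (2 * p) u * lpOn S (2 * p) y

namespace IsCentralizer

variable {p C : ℝ} {Φ : (ℕ → ℝ) → (ℕ → ℝ)}

/-- Kalton's lifting of a centralizer on `ℓ_p` to a positively homogeneous map on `ℓ_{2 p}`. -/
lemma exists_lift (hΦ : IsCentralizer p C Φ) (hp : 1 ≤ p) (hC : 0 < C) :
    ∃ (K : ℝ) (ξ : (ℕ → ℝ) → (ℕ → ℝ)), 0 < K ∧ IsLift p K Φ ξ := by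
  have hp0 : 0 < p := by linarith
  have h2p0 : 0 < 2 * p := by linarith
  obtain ⟨K, hK, hlift⟩ := exists_lift_of_le_one hp
  have hunit : ∀ u : ℕ → ℝ, ∃ ξ : ℕ → ℝ, FinSupp u → pNorm (2 * p) u ≤ 1 →
      (∀ n, u n = 0 → ξ n = 0) ∧ ∀ (S : Finset ℕ) (y : ℕ → ℝ), (∀ n ∉ S, y n = 0) →
        (∀ n ∉ S, u n = 0) →
        lpOn S p (fun n => ξ n * y n - Φ (fun k => u k * y k) n)
          ≤ K * C * lpOn S (2 * p) y := by
    intro u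
    by_cases h : FinSupp u ∧ pNorm (2 * p) u ≤ 1
    swap
    · exact ⟨0, fun h1 h2 => absurd ⟨h1, h2⟩ h⟩
    obtain ⟨hu, hu1⟩ := h
    set S₀ := Set.Finite.toFinset hu with hS₀
    have huS₀ : ∀ n ∉ S₀, u n = 0 := hu.eq_zero_of_notMem
    have hmem : ∀ n, u n = 0 → n ∉ S₀ := fun n hn hnS =>
      (Set.Finite.mem_toFinset hu).1 hnS hn
    obtain ⟨ξ, hξ⟩ := hlift C Φ hΦ hC S₀ u huS₀ (by rwa [← pNorm_eq_lpOn h2p0 huS₀])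
    refine ⟨fun n => if n ∈ S₀ then ξ n else 0, fun _ _ => ⟨fun n hn => if_neg (hmem n hn),
      fun S y hy huS => ?_⟩⟩
    set y₀ : ℕ → ℝ := fun n => if n ∈ S₀ then y n else 0 with hy₀
    have hy₀S₀ : ∀ n ∉ S₀, y₀ n = 0 := fun n hn => if_neg hn
    have hy₀S : ∀ n ∉ S, y₀ n = 0 := fun n hn => by simp [hy₀, hy n hn]
    have e1 : (fun k => u k * y k) = fun k => u k * y₀ k := by
      funext k
      by_cases hk : k ∈ S₀
      · simp [hy₀, hk]
      · simp [huS₀ k hk]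
    have e2 : (fun n => (if n ∈ S₀ then ξ n else 0) * y n - Φ (fun k => u k * y k) n)
        = fun n => ξ n * y₀ n - Φ (fun k => u k * y₀ k) n := by
      funext n
      rw [e1]
      by_cases hn : n ∈ S₀ <;> simp [hy₀, hn]
    have hΦ0 : ∀ n, u n = 0 → Φ (fun k => u k * y₀ k) n = 0 := fun n hn =>
      hΦ.supp _ (finSupp_of_forall_notMem (S := S₀) fun k hk => by rw [huS₀ k hk, zero_mul]) n
        (by rw [hn, zero_mul])
    rw [e2, ← pNorm_eq_lpOn hp0 (fun n hn => by rw [hy₀S n hn, hΦ0 n (huS n hn)]; ring),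
      pNorm_eq_lpOn hp0 (S := S₀) (fun n hn => by rw [hy₀S₀ n hn, hΦ0 n (huS₀ n hn)]; ring)]
    refine (hξ y₀ hy₀S₀).trans (mul_le_mul_of_nonneg_left ?_ (by positivity))
    rw [← pNorm_eq_lpOn h2p0 hy₀S₀, pNorm_eq_lpOn h2p0 hy₀S]
    exact lpOn_mono h2p0 fun n _ => by
      by_cases hn : n ∈ S₀ <;> simp [hy₀, hn]
  choose Ξ hΞ using hunit
  have hnorm : ∀ (c : ℝ) (u : ℕ → ℝ), FinSupp u →
      pNorm (2 * p) (fun n => c * u n) = |c| * pNorm (2 * p) u := fun c u hu => by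
    rw [pNorm_eq_lpOn h2p0 hu.eq_zero_of_notMem, ← lpOn_const_mul h2p0]
    exact pNorm_eq_lpOn h2p0 fun n hn => by rw [hu.eq_zero_of_notMem n hn, mul_zero]
  have hnn : ∀ u : ℕ → ℝ, FinSupp u → 0 ≤ pNorm (2 * p) u := fun u hu => by
    rw [pNorm_eq_lpOn h2p0 hu.eq_zero_of_notMem]
    exact lpOn_nonneg _ _ _
  have hsmul : ∀ (c : ℝ) (u : ℕ → ℝ), FinSupp u → FinSupp (fun n => c * u n) := fun c u hu =>
    finSupp_of_forall_notMem fun n hn => by rw [hu.eq_zero_of_notMem n hn, mul_zero]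
  have hnormalized : ∀ u : ℕ → ℝ, FinSupp u →
      pNorm (2 * p) (fun n => (pNorm (2 * p) u)⁻¹ * u n) ≤ 1 := fun u hu => by
    rw [hnorm _ _ hu, abs_of_nonneg (inv_nonneg.2 (hnn u hu))]
    exact inv_mul_le_one
  refine ⟨K * C, fun u n => pNorm (2 * p) u * Ξ (fun k => (pNorm (2 * p) u)⁻¹ * u k) n,
    by positivity, fun c u hu hc => ?_, fun u hu n hn => ?_, fun S u y huS hyS => ?_⟩
  · funext n
    dsimp only
    rw [hnorm c u hu, abs_of_nonneg hc]
    rcases hc.eq_or_lt with rfl | hc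
    · simp
    · have : (fun k => (c * pNorm (2 * p) u)⁻¹ * (c * u k))
          = fun k => (pNorm (2 * p) u)⁻¹ * u k := by
        funext k
        rw [mul_inv]
        field_simp
      rw [this, mul_assoc]
  · rw [(hΞ _ (hsmul _ _ hu) (hnormalized u hu)).1 n (by rw [hn, mul_zero]), mul_zero]
  · have hu := finSupp_of_forall_notMem huS
    set N := pNorm (2 * p) u with hN
    rw [← pNorm_eq_lpOn h2p0 huS, ← hN]
    have huyS : ∀ n ∉ S, u n * y n = 0 := fun n hn => by rw [huS n hn, zero_mul]
    rcases (hnn u hu).eq_or_lt with h0 | h0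
    · have hu0 : ∀ n, u n = 0 := fun n => by
        by_cases hn : n ∈ S
        · have := abs_le_lpOn h2p0 u hn
          rw [← pNorm_eq_lpOn h2p0 huS, ← h0] at this
          exact abs_nonpos_iff.1 this
        · exact huS n hn
      rw [hN, ← h0, mul_zero, zero_mul]
      refine (lpOn_zero hp0 fun n _ => ?_).le
      rw [hΦ.supp _ (finSupp_of_forall_notMem huyS) n (by rw [hu0, zero_mul])]
      simp
    · rw [← hN] at h0
      have h1 := (hΞ _ (hsmul _ _ hu) (hnormalized u hu)).2 S y hyS fun n hn => by
        rw [huS n hn, mul_zero]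
      rw [← hN] at h1
      have e1 : (fun k => N⁻¹ * u k * y k) = fun k => N⁻¹ * (u k * y k) := by
        funext k; ring
      have e2 : (fun n => N * Ξ (fun k => N⁻¹ * u k) n * y n - Φ (fun k => u k * y k) n)
          = fun n => N * (Ξ (fun k => N⁻¹ * u k) n * y n
            - Φ (fun k => N⁻¹ * u k * y k) n) := by
        funext n
        rw [e1, hΦ.homog _ _ (finSupp_of_forall_notMem huyS)]
        field_simp
      rw [e2, lpOn_const_mul hp0, abs_of_pos h0]
      calc _ ≤ N * (K * C * lpOn S (2 * p) y) := mul_le_mul_of_nonneg_left h1 h0.le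
        _ = _ := by ring

/-- Centralizers are quasi-linear. -/
lemma quasilinear (hΦ : IsCentralizer p C Φ) (hp : 1 ≤ p) (hC : 0 < C) {S : Finset ℕ}
    {g h : ℕ → ℝ} (hg : ∀ n ∉ S, g n = 0) (hh : ∀ n ∉ S, h n = 0) :
    lpOn S p (fun n => Φ (fun k => g k + h k) n - Φ g n - Φ h n)
      ≤ 3 * C * (lpOn S p g + lpOn S p h) := by
  have hp0 : 0 < p := by linarith
  set m : ℕ → ℝ := fun n => |g n| + |h n| with hmdef
  have hm : ∀ n, 0 ≤ m n := fun n => by positivity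
  have hmS : ∀ n ∉ S, m n = 0 := fun n hn => by simp [hmdef, hg n hn, hh n hn]
  have hmN : lpOn S p m ≤ lpOn S p g + lpOn S p h := by
    refine (lpOn_add_le hp _ _).trans (add_le_add ?_ ?_) <;>
      exact lpOn_mono hp0 fun n _ => by rw [abs_abs]
  have key : ∀ f : ℕ → ℝ, (∀ n, |f n| ≤ m n) →
      lpOn S p (fun n => Φ f n - f n / m n * Φ m n) ≤ C * lpOn S p m := by
    intro f hf
    have h1 := hΦ.cent S (fun n => f n / m n) m hmS fun n => by
      rw [abs_div, abs_of_nonneg (hm n)]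
      exact div_le_one_of_le₀ (hf n) (hm n)
    have e : (fun n => f n / m n * m n) = f := by
      funext n
      exact div_mul_cancel_of_imp fun h0 => abs_nonpos_iff.1 ((hf n).trans h0.le)
    rwa [e] at h1
  have k1 := key (fun n => g n + h n) fun n => abs_add_le _ _
  have k2 := key g fun n => by simp [hmdef]
  have k3 := key h fun n => by simp [hmdef]
  have e : (fun n => Φ (fun k => g k + h k) n - Φ g n - Φ h n)
      = fun n => (Φ (fun k => g k + h k) n - (g n + h n) / m n * Φ m n)
        - (Φ g n - g n / m n * Φ m n) - (Φ h n - h n / m n * Φ m n) := by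
    funext n; ring
  rw [e]
  have t1 := lpOn_sub_le (S := S) hp
    (fun n => (Φ (fun k => g k + h k) n - (g n + h n) / m n * Φ m n)
        - (Φ g n - g n / m n * Φ m n)) (fun n => Φ h n - h n / m n * Φ m n)
  have t2 := lpOn_sub_le (S := S) hp
    (fun n => Φ (fun k => g k + h k) n - (g n + h n) / m n * Φ m n)
    (fun n => Φ g n - g n / m n * Φ m n)
  have := mul_le_mul_of_nonneg_left hmN hC.le
  linarith

end IsCentralizer

/-- The homotopy trivializing the concatenation of `Φ` with itself, built from a lift `ξ`. -/
noncomputable def concatHomotopy (Φ ξ : (ℕ → ℝ) → (ℕ → ℝ)) (x : ℕ → ℝ) (n : ℕ) : ℝ :=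
  1 / 2 * Real.sign (x n) * ξ (fun k => √|x k|) n ^ 2
    + Φ (fun k => Φ x k - Real.sign (x k) * √|x k| * ξ (fun k => √|x k|) k) n

namespace IsCentralizer

variable {p C K : ℝ} {Φ ξ : (ℕ → ℝ) → (ℕ → ℝ)}

lemma concatHomotopy_eq_zero (hΦ : IsCentralizer p C Φ) {x : ℕ → ℝ} (hx : FinSupp x)
    {n : ℕ} (hn : x n = 0) : concatHomotopy Φ ξ x n = 0 := by
  have hB : ∀ k, x k = 0 →
      Φ x k - Real.sign (x k) * √|x k| * ξ (fun k => √|x k|) k = 0 := fun k hk => by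
    rw [hΦ.supp x hx k hk, hk]
    simp
  unfold concatHomotopy
  rw [hΦ.supp _ (finSupp_of_forall_notMem fun k hk => hB k (hx.eq_zero_of_notMem k hk)) n
    (hB n hn), hn]
  simp

lemma concatHomotopy_const_mul (hΦ : IsCentralizer p C Φ) (hξ : IsLift p K Φ ξ) (c : ℝ)
    {x : ℕ → ℝ} (hx : FinSupp x) (n : ℕ) :
    concatHomotopy Φ ξ (fun k => c * x k) n = c * concatHomotopy Φ ξ x n := by
  have hr : (fun k => √|c * x k|) = fun k => √|c| * √|x k| := by
    funext k
    rw [abs_mul, Real.sqrt_mul (abs_nonneg c)]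
  have hsq : √|c| * √|c| = |c| := Real.mul_self_sqrt (abs_nonneg c)
  have hc : Real.sign c * (√|c| * √|c|) = c := by rw [hsq, sign_mul_abs']
  have hξc := hξ.homog (√|c|) (fun k => √|x k|)
    (finSupp_of_forall_notMem (S := Set.Finite.toFinset hx) fun k hk => by
      rw [hx.eq_zero_of_notMem k hk, abs_zero, Real.sqrt_zero])
    (Real.sqrt_nonneg _)
  have hB : (fun k => Φ (fun k => c * x k) k
      - Real.sign (c * x k) * √|c * x k| * ξ (fun k => √|c * x k|) k)
      = fun k => c * (Φ x k - Real.sign (x k) * √|x k| * ξ (fun k => √|x k|) k) := by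
    funext k
    rw [hr, hξc, hΦ.homog c x hx, sign_mul', abs_mul, Real.sqrt_mul (abs_nonneg c)]
    linear_combination (- (Real.sign (x k) * √|x k| * ξ (fun k => √|x k|) k)) * hc
  unfold concatHomotopy
  rw [hB, hΦ.homog c _ (finSupp_of_forall_notMem fun k hk => by
    rw [hΦ.supp x hx k (hx.eq_zero_of_notMem k hk), hx.eq_zero_of_notMem k hk]; simp),
    hr, hξc, sign_mul']
  linear_combination (1 / 2 * Real.sign (x n) * ξ (fun k => √|x k|) n ^ 2) * hc

/-- Both `Φ` and the homotopy are nearly multiplication operators on the order interval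
`[-v, v]`, and the errors match up to `Φ`. -/
lemma exists_interval_approx (hΦ : IsCentralizer p C Φ) (hξ : IsLift p K Φ ξ) (hp : 1 ≤ p)
    (hC : 0 < C) (hK : 0 < K) {S : Finset ℕ} {v z : ℕ → ℝ} (hv : ∀ n, 0 ≤ v n)
    (hvS : ∀ n ∉ S, v n = 0) (hz : ∀ n, |z n| ≤ v n) :
    ∃ c : ℕ → ℝ, (∀ n ∉ S, c n = 0) ∧
      (∀ n, Φ z n = z n / v n * (√(v n) * ξ (fun k => √(v k)) n) + c n) ∧
      lpOn S p c ≤ 3 * K * lpOn S p v ∧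
      lpOn S p (fun n => concatHomotopy Φ ξ z n
        - z n / v n * (1 / 2 * ξ (fun k => √(v k)) n ^ 2) - Φ c n)
        ≤ (4 * K ^ 2 + 9 * C * K) * lpOn S p v := by
  have hp0 : 0 < p := by linarith
  have h2p0 : 0 < 2 * p := by linarith
  have hzS : ∀ n ∉ S, z n = 0 := fun n hn => abs_nonpos_iff.1 ((hz n).trans (hvS n hn).le)
  have hzf := finSupp_of_forall_notMem hzS
  set u : ℕ → ℝ := fun k => √|z k| with hu
  set w : ℕ → ℝ := fun k => √(v k) with hw
  set s : ℕ → ℝ := fun k => Real.sign (z k) with hs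
  set α : ℕ → ℝ := fun k => u k / w k with hα
  set X := ξ u with hX
  set Y := ξ w with hY
  set e : ℕ → ℝ := fun k => X k - α k * Y k with he
  have hu0 : ∀ n, 0 ≤ u n := fun n => Real.sqrt_nonneg _
  have hw0 : ∀ n, 0 ≤ w n := fun n => Real.sqrt_nonneg _
  have huw : ∀ n, u n ≤ w n := fun n => Real.sqrt_le_sqrt (hz n)
  have huu : ∀ n, u n * u n = |z n| := fun n => Real.mul_self_sqrt (abs_nonneg _)
  have hww : ∀ n, w n * w n = v n := fun n => Real.mul_self_sqrt (hv n)
  have hsu : ∀ n, s n * (u n * u n) = z n := fun n => by rw [huu]; exact sign_mul_abs' _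
  have hs1 : ∀ n, |s n| ≤ 1 := fun n => abs_sign_le_one _
  have hwS : ∀ n ∉ S, w n = 0 := fun n hn => by simp [hw, hvS n hn]
  have huS : ∀ n ∉ S, u n = 0 := fun n hn => by simp [hu, hzS n hn]
  have hXS : ∀ n ∉ S, X n = 0 := fun n hn =>
    hξ.supp _ (finSupp_of_forall_notMem huS) n (huS n hn)
  have hαS : ∀ n ∉ S, α n = 0 := fun n hn => by simp [hα, huS n hn]
  have heS : ∀ n ∉ S, e n = 0 := fun n hn => by simp [he, hXS n hn, hαS n hn]
  have hα1 : ∀ n, |α n| ≤ 1 := fun n => by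
    rw [abs_of_nonneg (div_nonneg (hu0 n) (hw0 n))]
    exact div_le_one_of_le₀ (huw n) (hw0 n)
  have hwα : ∀ n, w n * α n = u n := fun n =>
    mul_div_cancel_of_imp' fun h => le_antisymm ((huw n).trans h.le) (hu0 n)
  have hzv : ∀ n, z n / v n = s n * (α n * α n) := fun n => by
    rw [← hsu n, ← hww n, hα]
    ring
  have hzvw : ∀ n, z n / v n * w n = s n * u n * α n := fun n => by
    rw [hzv n, ← hwα n]
    ring
  set W := lpOn S (2 * p) w with hWdef
  have hW0 : 0 ≤ W := lpOn_nonneg _ _ _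
  have hV : lpOn S p v = W ^ 2 := by
    rw [hWdef, ← lpOn_mul_self hp0]
    simp_rw [hww]
  have huW : lpOn S (2 * p) u ≤ W := lpOn_mono h2p0 fun n _ => by
    rw [abs_of_nonneg (hu0 n), abs_of_nonneg (hw0 n)]
    exact huw n
  have hsuW : lpOn S (2 * p) (fun n => s n * u n) ≤ W :=
    (lpOn_mul_le_of_bounded h2p0 fun n _ => hs1 n).trans huW
  have hmult : ∀ y : ℕ → ℝ, (∀ n ∉ S, y n = 0) →
      lpOn S p (fun n => e n * y n) ≤ 2 * K * W * lpOn S (2 * p) y := by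
    intro y hy
    have hy0 := lpOn_nonneg S (2 * p) y
    have h1 := hξ.lift S u y huS hy
    have h2 := hξ.lift S w (fun n => α n * y n) hwS fun n hn => by rw [hy n hn, mul_zero]
    have h3 : lpOn S (2 * p) (fun n => α n * y n) ≤ lpOn S (2 * p) y :=
      lpOn_mul_le_of_bounded h2p0 fun n _ => hα1 n
    have e1 : (fun k => w k * (α k * y k)) = fun k => u k * y k := by
      funext k
      rw [← mul_assoc, hwα]
    rw [e1] at h2
    have e2 : (fun n => e n * y n) = fun n => (X n * y n - Φ (fun k => u k * y k) n)
        - (Y n * (α n * y n) - Φ (fun k => u k * y k) n) := by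
      funext n
      simp only [he]
      ring
    rw [e2]
    refine (lpOn_sub_le hp _ _).trans ((add_le_add h1 h2).trans ?_)
    have h4 : K * lpOn S (2 * p) u * lpOn S (2 * p) y ≤ K * W * lpOn S (2 * p) y := by gcongr
    have h5 : K * W * lpOn S (2 * p) (fun n => α n * y n) ≤ K * W * lpOn S (2 * p) y := by
      gcongr
    linarith
  set E := lpOn S (2 * p) e with hEdef
  have hE0 : 0 ≤ E := lpOn_nonneg _ _ _
  have hEW : E ≤ 2 * K * W := by
    have h := hmult e heS
    rw [lpOn_mul_self hp0, ← hEdef] at h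
    rcases hE0.eq_or_lt with h0 | h0
    · rw [← h0]
      positivity
    · exact le_of_mul_le_mul_right (by rw [← pow_two]; exact h) h0
  set b : ℕ → ℝ := fun n => e n * (s n * u n) with hb
  set B : ℕ → ℝ := fun n => Φ z n - s n * u n * X n with hB
  have hbS : ∀ n ∉ S, b n = 0 := fun n hn => by simp [hb, heS n hn]
  have hBS : ∀ n ∉ S, B n = 0 := fun n hn => by
    simp [hB, huS n hn, hΦ.supp z hzf n (hzS n hn)]
  have hbN : lpOn S p b ≤ 2 * K * W ^ 2 := by
    refine (hmult (fun n => s n * u n) fun n hn => by rw [huS n hn, mul_zero]).trans ?_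
    rw [pow_two, ← mul_assoc]
    gcongr
  have hBN : lpOn S p B ≤ K * W ^ 2 := by
    have h := hξ.lift S u (fun n => s n * u n) huS fun n hn => by rw [huS n hn, mul_zero]
    have e1 : (fun k => u k * (s k * u k)) = z := by
      funext k
      rw [← hsu k]
      ring
    have e2 : (fun n => X n * (s n * u n) - Φ z n) = fun n => - B n := by
      funext n
      simp only [hB]
      ring
    rw [e1, e2, lpOn_neg] at h
    refine h.trans ?_
    rw [pow_two, ← mul_assoc]
    have := lpOn_nonneg S (2 * p) fun n => s n * u n
    gcongr
  have hc : (fun n => Φ z n - z n / v n * (w n * Y n)) = fun n => b n + B n := by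
    funext n
    rw [← mul_assoc, hzvw]
    simp only [hb, hB, he]
    ring
  refine ⟨fun n => b n + B n, fun n hn => by simp [hbS n hn, hBS n hn], fun n => ?_, ?_, ?_⟩
  · have := congrFun hc n
    dsimp only at this ⊢
    rw [← this]
    ring
  · rw [hV]
    refine (lpOn_add_le hp _ _).trans ?_
    linarith
  · have h1 := hΦ.quasilinear hp hC hbS hBS
    have h2 := hξ.lift S w (fun n => s n * α n * e n) hwS fun n hn => by
      rw [heS n hn, mul_zero]
    have e1 : (fun k => w k * (s k * α k * e k)) = b := by
      funext k
      simp only [hb]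
      rw [← hwα k]
      ring
    have h3 : lpOn S (2 * p) (fun n => s n * α n * e n) ≤ E :=
      lpOn_mul_le_of_bounded h2p0 fun n _ => by
        rw [abs_mul]
        exact mul_le_one₀ (hs1 n) (abs_nonneg _) (hα1 n)
    have h4 : lpOn S p (fun n => 1 / 2 * (s n * (e n * e n))) ≤ 1 / 2 * E ^ 2 := by
      rw [lpOn_const_mul hp0, abs_of_pos one_half_pos, ← lpOn_mul_self hp0]
      exact mul_le_mul_of_nonneg_left (lpOn_mul_le_of_bounded hp0 fun n _ => hs1 n)
        one_half_pos.le
    rw [e1] at h2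
    have e2 : (fun n => concatHomotopy Φ ξ z n - z n / v n * (1 / 2 * Y n ^ 2)
        - Φ (fun n => b n + B n) n)
        = fun n => (Y n * (s n * α n * e n) - Φ b n) + 1 / 2 * (s n * (e n * e n))
          - (Φ (fun n => b n + B n) n - Φ b n - Φ B n) := by
      funext n
      rw [hzv]
      change 1 / 2 * s n * X n ^ 2 + Φ B n - _ - _ = _
      simp only [he]
      ring
    rw [hV, e2]
    have t1 := lpOn_sub_le (S := S) hp
      (fun n => (Y n * (s n * α n * e n) - Φ b n) + 1 / 2 * (s n * (e n * e n)))
      (fun n => Φ (fun n => b n + B n) n - Φ b n - Φ B n)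
    have t2 := lpOn_add_le (S := S) hp (fun n => Y n * (s n * α n * e n) - Φ b n)
      (fun n => 1 / 2 * (s n * (e n * e n)))
    have t3 : K * W * lpOn S (2 * p) (fun n => s n * α n * e n) ≤ K * W * (2 * K * W) :=
      mul_le_mul_of_nonneg_left (h3.trans hEW) (by positivity)
    have t4 : E ^ 2 ≤ (2 * K * W) ^ 2 := pow_le_pow_left₀ hE0 hEW 2
    have t5 : 3 * C * (lpOn S p b + lpOn S p B) ≤ 3 * C * (2 * K * W ^ 2 + K * W ^ 2) :=
      mul_le_mul_of_nonneg_left (add_le_add hbN hBN) (by positivity)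
    linarith

lemma lpOn_concatHomotopy_le (hΦ : IsCentralizer p C Φ) (hξ : IsLift p K Φ ξ) (hp : 1 ≤ p)
    (hC : 0 < C) (hK : 0 < K) {S : Finset ℕ} {x x' : ℕ → ℝ} (hx : ∀ n ∉ S, x n = 0)
    (hx' : ∀ n ∉ S, x' n = 0) :
    lpOn S p (fun n => concatHomotopy Φ ξ (x + x') n - concatHomotopy Φ ξ x n
        - concatHomotopy Φ ξ x' n - Φ (Φ (x + x') - Φ x - Φ x') n)
      ≤ (12 * K ^ 2 + 90 * C * K) * (lpOn S p x + lpOn S p x') := by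
  have hp0 : 0 < p := by linarith
  set v : ℕ → ℝ := fun n => |x n| + |x' n| with hvdef
  have hv : ∀ n, 0 ≤ v n := fun n => by positivity
  have hvS : ∀ n ∉ S, v n = 0 := fun n hn => by simp [hvdef, hx n hn, hx' n hn]
  have hvN : lpOn S p v ≤ lpOn S p x + lpOn S p x' := by
    refine (lpOn_add_le hp _ _).trans (add_le_add ?_ ?_) <;>
      exact lpOn_mono hp0 fun n _ => by rw [abs_abs]
  obtain ⟨c, hcS, hcΦ, hcN, hcH⟩ :=
    hΦ.exists_interval_approx hξ hp hC hK hv hvS (z := x) fun n => by simp [hvdef]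
  obtain ⟨c', hcS', hcΦ', hcN', hcH'⟩ :=
    hΦ.exists_interval_approx hξ hp hC hK hv hvS (z := x') fun n => by simp [hvdef]
  obtain ⟨t, htS, htΦ, htN, htH⟩ :=
    hΦ.exists_interval_approx hξ hp hC hK hv hvS (z := x + x') fun n => abs_add_le _ _
  set d : ℕ → ℝ := fun n => t n - (c n + c' n) with hd
  have hΦd : Φ (x + x') - Φ x - Φ x' = d := by
    funext n
    simp only [hd, Pi.sub_apply]
    rw [hcΦ, hcΦ', htΦ, Pi.add_apply]
    ring
  have hcc : lpOn S p (fun n => c n + c' n) ≤ 6 * K * lpOn S p v := by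
    refine (lpOn_add_le hp _ _).trans ?_
    linarith
  have hdN : lpOn S p d ≤ 9 * K * lpOn S p v := by
    refine (lpOn_sub_le hp _ _).trans ?_
    linarith
  have q1 := hΦ.quasilinear hp hC (S := S) (g := d) (h := fun n => c n + c' n)
    (fun n hn => by simp [hd, htS n hn, hcS n hn, hcS' n hn])
    (fun n hn => by simp [hcS n hn, hcS' n hn])
  have q2 := hΦ.quasilinear hp hC hcS hcS'
  have e1 : (fun k => d k + (c k + c' k)) = t := by
    funext k
    simp [hd]
  rw [e1] at q1
  have e2 : (fun n => concatHomotopy Φ ξ (x + x') n - concatHomotopy Φ ξ x n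
        - concatHomotopy Φ ξ x' n - Φ d n)
      = fun n => (((concatHomotopy Φ ξ (x + x') n
          - (x + x') n / v n * (1 / 2 * ξ (fun k => √(v k)) n ^ 2) - Φ t n)
        - (concatHomotopy Φ ξ x n
          - x n / v n * (1 / 2 * ξ (fun k => √(v k)) n ^ 2) - Φ c n))
        - (concatHomotopy Φ ξ x' n
          - x' n / v n * (1 / 2 * ξ (fun k => √(v k)) n ^ 2) - Φ c' n))
        + ((Φ t n - Φ d n - Φ (fun k => c k + c' k) n)
          + (Φ (fun k => c k + c' k) n - Φ c n - Φ c' n)) := by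
    funext n
    rw [Pi.add_apply]
    ring
  rw [hΦd, e2]
  refine (lpOn_add_le hp _ _).trans ((add_le_add ((lpOn_sub_le hp _ _).trans
    (add_le_add ((lpOn_sub_le hp _ _).trans (add_le_add htH hcH)) hcH'))
    ((lpOn_add_le hp _ _).trans (add_le_add q1 q2))).trans ?_)
  have r1 : 3 * C * (lpOn S p d + lpOn S p fun n => c n + c' n)
      ≤ 3 * C * (9 * K * lpOn S p v + 6 * K * lpOn S p v) := by gcongr
  have r2 : 3 * C * (lpOn S p c + lpOn S p c')
      ≤ 3 * C * (3 * K * lpOn S p v + 3 * K * lpOn S p v) := by gcongr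
  have r3 : (12 * K ^ 2 + 90 * C * K) * lpOn S p v
      ≤ (12 * K ^ 2 + 90 * C * K) * (lpOn S p x + lpOn S p x') := by gcongr
  linarith

end IsCentralizer

/-- Let `1 ≤ p < ∞` and let `Φ : c00 → c00` be a homogeneous
support-preserving centralizer on `ℓ_p`, i.e.
`‖Φ(a·x) − a·Φ(x)‖_p ≤ C‖a‖_∞‖x‖_p` for bounded `a` and `x ∈ c00`. Then there are a
homogeneous map `H : c00 → ℓ_p` and a constant `K` with
`‖H(x+x') − H(x) − H(x') − Φ(Φ(x+x') − Φ(x) − Φ(x'))‖_p ≤ K(‖x‖_p + ‖x'‖_p)` for all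
`x, x' ∈ c00`. (The concatenation `Φ·Φ` is trivial in `Ext²(ℓ_p, ℓ_p)`.) -/
theorem centralizer_self_concatenation_trivial
    (p : ℝ) (hp : 1 ≤ p)
    (Φ : (ℕ → ℝ) → (ℕ → ℝ))
    (hΦ_c00 : ∀ x, FinSupp x → FinSupp (Φ x))
    (hΦ_homog : ∀ (c : ℝ) (x : ℕ → ℝ), FinSupp x → Φ (c • x) = c • Φ x)
    (hΦ_supp : ∀ x : ℕ → ℝ, FinSupp x → ∀ n, x n = 0 → Φ x n = 0)
    (C : ℝ)
    (hΦ_cent : ∀ (a x : ℕ → ℝ), FinSupp x → ∀ M : ℝ, (∀ n, |a n| ≤ M) →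
      pNorm p (fun n => Φ (fun m => a m * x m) n - a n * Φ x n) ≤ C * M * pNorm p x) :
    ∃ (H : (ℕ → ℝ) → (ℕ → ℝ)) (K : ℝ),
      (∀ x, FinSupp x → Summable (fun n => |H x n| ^ p)) ∧
      (∀ (c : ℝ) (x : ℕ → ℝ), FinSupp x → H (c • x) = c • H x) ∧
      (∀ x x' : ℕ → ℝ, FinSupp x → FinSupp x' →
        pNorm p (fun n => H (x + x') n - H x n - H x' n
            - Φ (Φ (x + x') - Φ x - Φ x') n)
          ≤ K * (pNorm p x + pNorm p x')) := by
  have hp0 : 0 < p := by linarith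
  have hΦ : IsCentralizer p (max C 1) Φ := by
    refine ⟨hΦ_homog, hΦ_supp, fun S a x hx ha => ?_⟩
    have hxf := finSupp_of_forall_notMem hx
    have h := hΦ_cent a x hxf 1 ha
    rw [mul_one, pNorm_eq_lpOn hp0 hx, pNorm_eq_lpOn hp0 (S := S) fun n hn => by
      rw [hΦ_supp x hxf n (hx n hn), hΦ_supp _ (finSupp_of_forall_notMem (S := S) fun k hk => by
        rw [hx k hk, mul_zero]) n (by rw [hx n hn, mul_zero])]
      ring] at h
    exact h.trans (mul_le_mul_of_nonneg_right (le_max_left _ _) (lpOn_nonneg _ _ _))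
  have hC : 0 < max C 1 := zero_lt_one.trans_le (le_max_right _ _)
  obtain ⟨K, ξ, hK, hξ⟩ := hΦ.exists_lift hp hC
  refine ⟨concatHomotopy Φ ξ, 12 * K ^ 2 + 90 * max C 1 * K, fun x hx => ?_, fun c x hx => ?_,
    fun x x' hx hx' => ?_⟩
  · refine summable_of_ne_finset_zero (s := Set.Finite.toFinset hx) fun n hn => ?_
    rw [hΦ.concatHomotopy_eq_zero hx (hx.eq_zero_of_notMem n hn), abs_zero,
      Real.zero_rpow hp0.ne']
  · funext n
    exact hΦ.concatHomotopy_const_mul hξ c hx n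
  · set S := Set.Finite.toFinset hx ∪ Set.Finite.toFinset hx' with hS
    have hxS : ∀ n ∉ S, x n = 0 := fun n hn =>
      hx.eq_zero_of_notMem n fun h => hn (Finset.mem_union_left _ h)
    have hxS' : ∀ n ∉ S, x' n = 0 := fun n hn =>
      hx'.eq_zero_of_notMem n fun h => hn (Finset.mem_union_right _ h)
    have hsS : ∀ n ∉ S, (x + x') n = 0 := fun n hn => by
      rw [Pi.add_apply, hxS n hn, hxS' n hn, add_zero]
    have hsf := finSupp_of_forall_notMem hsS
    have hdS : ∀ n ∉ S, (Φ (x + x') - Φ x - Φ x') n = 0 := fun n hn => by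
      rw [Pi.sub_apply, Pi.sub_apply, hΦ_supp x hx n (hxS n hn), hΦ_supp x' hx' n (hxS' n hn),
        hΦ_supp _ hsf n (hsS n hn)]
      ring
    rw [pNorm_eq_lpOn hp0 hxS, pNorm_eq_lpOn hp0 hxS', pNorm_eq_lpOn hp0 (S := S) fun n hn => by
      rw [hΦ.concatHomotopy_eq_zero hx (hxS n hn),
        hΦ.concatHomotopy_eq_zero hx' (hxS' n hn),
        hΦ.concatHomotopy_eq_zero hsf (hsS n hn),
        hΦ_supp _ (finSupp_of_forall_notMem hdS) n (hdS n hn)]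
      ring]
    exact hΦ.lpOn_concatHomotopy_le hξ hp hC hK hxS hxS'
end

section
/- Define inductively the Enflo–Lindenstrauss–Pisier maps Γ_n, P_n : ℝ^{3^n} → ℝ^{3^n} as follows, identifying ℝ^{3^n} with the set of triples (x, y, z) with x, y, z ∈ ℝ^{3^{n−1}} (and ℝ^{3^0} = ℝ): Γ₁(x,y,z) = (x, y, x|y|/(x² + y²)^{1/2}) for scalars x, y, z (with third coordinate 0 when x = y = 0), P₁(x,y,z) = (x,y,0); and for n ≥ 2, Γ_n(x,y,z) = (Γ_{n−1}(P_{n−1}(x)), Γ_{n−1}(P_{n−1}(y)), P_{n−1}(x)·‖P_{n−1}(y)‖/(‖P_{n−1}(x)‖² + ‖P_{n−1}(y)‖²)^{1/2}) (with third block 0 when P_{n−1}(x) = P_{n−1}(y) = 0) and P_n(x,y,z) = (P_{n−1}(x), P_{n−1}(y), 0), where ‖·‖ is the Euclidean norm on ℝ^{3^{n−1}}. Then for every n ≥ 1 and all u, v ∈ ℝ^{3^n}: Γ_n(Γ_n(u+v) − Γ_n(u) − Γ_n(v)) = 0. -/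
/-- `ELPSpace n` is `ℝ^{3^n}`, realized as the orthogonal direct sum of three copies
of `ℝ^{3^{n−1}}` (with `ℝ^{3^0} = ℝ`). -/
def ELPSpace : ℕ → Type
  | 0 => ℝ
  | n + 1 => ELPSpace n × ELPSpace n × ELPSpace n

instance instELPGroup : (n : ℕ) → AddCommGroup (ELPSpace n)
  | 0 => inferInstanceAs (AddCommGroup ℝ)
  | n + 1 =>
      letI := instELPGroup n
      inferInstanceAs (AddCommGroup (ELPSpace n × ELPSpace n × ELPSpace n))

/-- The square of the Euclidean norm on `ℝ^{3^n}`. -/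
noncomputable def sqn : (n : ℕ) → ELPSpace n → ℝ
  | 0, x => (show ℝ from x) ^ 2
  | n + 1, (x, y, z) => sqn n x + sqn n y + sqn n z

/-- Scalar multiplication on `ℝ^{3^n}`. -/
noncomputable def esmul : (n : ℕ) → ℝ → ELPSpace n → ELPSpace n
  | 0, c, x => show ELPSpace 0 from c * (show ℝ from x)
  | n + 1, c, (x, y, z) => (esmul n c x, esmul n c y, esmul n c z)

/-- The Enflo–Lindenstrauss–Pisier projections `P_n : ℝ^{3^n} → ℝ^{3^n}`,
`P_n(x,y,z) = (P_{n−1}(x), P_{n−1}(y), 0)`, with `P_0 = id` (so that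
`P_1(x,y,z) = (x,y,0)`). -/
noncomputable def Pmap : (n : ℕ) → ELPSpace n → ELPSpace n
  | 0, x => x
  | n + 1, (x, y, _) => (Pmap n x, Pmap n y, 0)

/-- The Enflo–Lindenstrauss–Pisier maps `Γ_n : ℝ^{3^n} → ℝ^{3^n}`,
`Γ_n(x,y,z) = (Γ_{n−1}(P_{n−1}x), Γ_{n−1}(P_{n−1}y),
P_{n−1}(x)·‖P_{n−1}y‖/(‖P_{n−1}x‖² + ‖P_{n−1}y‖²)^{1/2})`, with `Γ_0 = id` (so that
`Γ_1(x,y,z) = (x, y, x|y|/(x² + y²)^{1/2})`); the third block is `0` when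
`P_{n−1}x = P_{n−1}y = 0`, by the convention that division by zero gives zero. -/
noncomputable def Gmap : (n : ℕ) → ELPSpace n → ELPSpace n
  | 0, x => x
  | n + 1, (x, y, _) =>
      (Gmap n (Pmap n x), Gmap n (Pmap n y),
        esmul n (Real.sqrt (sqn n (Pmap n y)) /
          Real.sqrt (sqn n (Pmap n x) + sqn n (Pmap n y))) (Pmap n x))

theorem Pmap_sub (n : ℕ) (u v : ELPSpace n) : Pmap n (u - v) = Pmap n u - Pmap n v := by
  induction n with
  | zero => rfl
  | succ n ih =>
    obtain ⟨x, y, z⟩ := u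
    obtain ⟨x', y', z'⟩ := v
    change (Pmap n (x - x'), Pmap n (y - y'), (0 : ELPSpace n)) =
      (Pmap n x - Pmap n x', Pmap n y - Pmap n y', (0 : ELPSpace n) - 0)
    rw [ih, ih, sub_zero]

theorem Pmap_zero (n : ℕ) : Pmap n 0 = 0 := by
  simpa using Pmap_sub n 0 0

theorem Pmap_add (n : ℕ) (u v : ELPSpace n) : Pmap n (u + v) = Pmap n u + Pmap n v := by
  rw [← sub_neg_eq_add, Pmap_sub, ← zero_sub, Pmap_sub, Pmap_zero, zero_sub, sub_neg_eq_add]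

theorem Pmap_Pmap (n : ℕ) (u : ELPSpace n) : Pmap n (Pmap n u) = Pmap n u := by
  induction n with
  | zero => rfl
  | succ n ih =>
    obtain ⟨x, y, z⟩ := u
    change (Pmap n (Pmap n x), Pmap n (Pmap n y), (0 : ELPSpace n)) =
      (Pmap n x, Pmap n y, (0 : ELPSpace n))
    rw [ih, ih]

theorem Pmap_Gmap (n : ℕ) (u : ELPSpace n) : Pmap n (Gmap n u) = Pmap n u := by
  induction n with
  | zero => rfl
  | succ n ih =>
    obtain ⟨x, y, z⟩ := u
    change (Pmap n (Gmap n (Pmap n x)), Pmap n (Gmap n (Pmap n y)), (0 : ELPSpace n)) =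
      (Pmap n x, Pmap n y, (0 : ELPSpace n))
    rw [ih, ih, Pmap_Pmap, Pmap_Pmap]

theorem esmul_zero (n : ℕ) (c : ℝ) : esmul n c 0 = 0 := by
  induction n with
  | zero => exact mul_zero c
  | succ n ih =>
    change (esmul n c 0, esmul n c 0, esmul n c 0) = ((0, 0, 0) : _ × _ × _)
    rw [ih]

theorem Gmap_eq_zero_of_Pmap_eq_zero (n : ℕ) (u : ELPSpace n) (h : Pmap n u = 0) :
    Gmap n u = 0 := by
  induction n with
  | zero => exact h
  | succ n ih =>
    obtain ⟨x, y, z⟩ := u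
    have hx : Pmap n x = 0 := congrArg Prod.fst h
    have hy : Pmap n y = 0 := congrArg (fun p => p.2.1) h
    change (Gmap n (Pmap n x), Gmap n (Pmap n y), esmul n _ (Pmap n x)) = ((0, 0, 0) : _ × _ × _)
    rw [hx, hy, ih 0 (Pmap_zero n), esmul_zero]

/-- For every `n ≥ 1` and all `u, v ∈ ℝ^{3^n}`:
`Γ_n(Γ_n(u+v) − Γ_n(u) − Γ_n(v)) = 0`. -/
theorem ELP_self_composition_vanishes (n : ℕ) (hn : 1 ≤ n) (u v : ELPSpace n) :
    Gmap n (Gmap n (u + v) - Gmap n u - Gmap n v) = 0 := by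
  apply Gmap_eq_zero_of_Pmap_eq_zero
  rw [Pmap_sub, Pmap_sub, Pmap_Gmap, Pmap_Gmap, Pmap_Gmap, Pmap_add]
  abel
end

section
/- Let X be a real Banach space equipped with a module multiplication (a, x) ↦ a·x by bounded sequences a : ℕ → ℝ which is bilinear, satisfies ‖a·x‖ ≤ ‖a‖_∞‖x‖ and 1_ℕ·x = x, and let X⁰ = {x ∈ X : x = 1_A·x for some finite A ⊆ ℕ} be the submodule of finitely supported elements. Let φ : X⁰ → ℝ be any map, and for i = 1, 2 let Φ_i : X⁰ → ℓ₁ be homogeneous maps satisfying the centralizer estimate ‖Φ_i(a·x) − a·Φ_i(x)‖₁ ≤ C(Φ_i)‖a‖_∞‖x‖ for every bounded sequence a and x ∈ X⁰, together with the approximation estimate |φ(x) − Σ_n Φ_i(x)(n)| ≤ C_i‖x‖ for all x ∈ X⁰. Then Φ₁ and Φ₂ are strongly equivalent; precisely, ‖Φ₁(x) − Φ₂(x)‖₁ ≤ (C₁ + C₂ + C(Φ₁) + C(Φ₂))‖x‖ for all x ∈ X⁰. -/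
open scoped ENNReal

/-- The Banach algebra `ℓ_∞` of bounded real sequences. -/
noncomputable abbrev Linf : Type := lp (fun _ : ℕ => ℝ) ∞

/-- The indicator sequence `1_A` of a finite set `A ⊆ ℕ`, as an element of `ℓ_∞`. -/
noncomputable def indLp (A : Finset ℕ) : Linf :=
  ⟨fun n => if n ∈ A then (1 : ℝ) else 0, by
    apply memℓp_infty
    refine ⟨1, ?_⟩
    rintro r ⟨n, rfl⟩
    dsimp
    split <;> simp⟩

/-- An element `x` of an `ℓ_∞`-module `X` is finitely supported (i.e. belongs to `X⁰`)
if `x = 1_A • x` for some finite `A ⊆ ℕ`. -/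
def FinSuppX {X : Type*} [AddCommGroup X] [Module Linf X] (x : X) : Prop :=
  ∃ A : Finset ℕ, indLp A • x = x

/-- The `ℓ₁` norm of a sequence, `‖f‖₁ = ∑ₙ |f n|`. -/
noncomputable def l1Norm (f : ℕ → ℝ) : ℝ := ∑' n, |f n|

/-- Submodule property: finitely supported elements are stable under the action of `ℓ_∞`. -/
theorem FinSuppX.smul {X : Type*} [AddCommGroup X] [Module Linf X] {x : X}
    (hx : FinSuppX x) (a : Linf) : FinSuppX (a • x) := by
  obtain ⟨A, hA⟩ := hx
  exact ⟨A, by rw [smul_smul, mul_comm, ← smul_smul, hA]⟩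

theorem l1Norm_nonneg (f : ℕ → ℝ) : 0 ≤ l1Norm f := tsum_nonneg fun _ => abs_nonneg _

theorem abs_tsum_le_l1Norm {f : ℕ → ℝ} (hf : Summable fun n => |f n|) :
    |∑' n, f n| ≤ l1Norm f := by
  simpa only [Real.norm_eq_abs, l1Norm] using norm_tsum_le_tsum_norm (f := f) hf

/-- The sequence of signs of a real sequence, as an element of `ℓ_∞`. -/
noncomputable def signLp (d : ℕ → ℝ) : Linf :=
  ⟨fun n => SignType.sign (d n), by
    apply memℓp_infty
    refine ⟨1, ?_⟩
    rintro r ⟨n, rfl⟩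
    rcases lt_trichotomy (d n) 0 with h | h | h <;> simp [h]⟩

theorem signLp_apply (d : ℕ → ℝ) (n : ℕ) : signLp d n = (SignType.sign (d n) : ℝ) := rfl

theorem norm_signLp_le_one (d : ℕ → ℝ) : ‖signLp d‖ ≤ 1 := by
  refine lp.norm_le_of_forall_le zero_le_one fun n => ?_
  rw [signLp_apply]
  rcases lt_trichotomy (d n) 0 with h | h | h <;> simp [h]

theorem summable_linf_mul (a : Linf) {f : ℕ → ℝ} (hf : Summable fun n => |f n|) :
    Summable fun n => a n * f n := by
  refine Summable.of_norm_bounded (hf.mul_left ‖a‖) fun n => ?_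
  rw [norm_mul, Real.norm_eq_abs (f n)]
  exact mul_le_mul_of_nonneg_right (lp.norm_apply_le_norm ENNReal.top_ne_zero a n) (abs_nonneg _)

/-- Let `X` be a real Banach space which is a module over `ℓ_∞` (the
module multiplication being bilinear, with `‖a • x‖ ≤ ‖a‖_∞‖x‖` and `1 • x = x`), with
`X⁰` its submodule of finitely supported elements. Let `φ : X⁰ → ℝ` be any map, and for
`i = 1, 2` let `Φ_i : X⁰ → ℓ₁` be homogeneous maps satisfying the centralizer estimate
`‖Φ_i(a • x) − a·Φ_i(x)‖₁ ≤ C(Φ_i)‖a‖_∞‖x‖` and the approximation estimate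
`|φ(x) − Σₙ Φ_i(x)(n)| ≤ C_i‖x‖` on `X⁰`. Then
`‖Φ₁(x) − Φ₂(x)‖₁ ≤ (C₁ + C₂ + C(Φ₁) + C(Φ₂))‖x‖` for all `x ∈ X⁰`. -/
theorem centralizers_approximating_phi_are_strongly_equivalent
    (X : Type*) [NormedAddCommGroup X] [NormedSpace ℝ X] [CompleteSpace X]
    [Module Linf X] [IsScalarTower ℝ Linf X]
    (hmod : ∀ (a : Linf) (x : X), ‖a • x‖ ≤ ‖a‖ * ‖x‖)
    (φ : X → ℝ) (Φ₁ Φ₂ : X → ℕ → ℝ)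
    (hΦ₁_l1 : ∀ x : X, FinSuppX x → Summable (fun n => |Φ₁ x n|))
    (hΦ₂_l1 : ∀ x : X, FinSuppX x → Summable (fun n => |Φ₂ x n|))
    (hΦ₁_homog : ∀ (c : ℝ) (x : X), FinSuppX x → Φ₁ (c • x) = c • Φ₁ x)
    (hΦ₂_homog : ∀ (c : ℝ) (x : X), FinSuppX x → Φ₂ (c • x) = c • Φ₂ x)
    (CΦ₁ CΦ₂ C₁ C₂ : ℝ)
    (hΦ₁_cent : ∀ (a : Linf) (x : X), FinSuppX x →
      l1Norm (fun n => Φ₁ (a • x) n - a n * Φ₁ x n) ≤ CΦ₁ * ‖a‖ * ‖x‖)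
    (hΦ₂_cent : ∀ (a : Linf) (x : X), FinSuppX x →
      l1Norm (fun n => Φ₂ (a • x) n - a n * Φ₂ x n) ≤ CΦ₂ * ‖a‖ * ‖x‖)
    (hΦ₁_approx : ∀ x : X, FinSuppX x → |φ x - ∑' n, Φ₁ x n| ≤ C₁ * ‖x‖)
    (hΦ₂_approx : ∀ x : X, FinSuppX x → |φ x - ∑' n, Φ₂ x n| ≤ C₂ * ‖x‖) :
    ∀ x : X, FinSuppX x →
      l1Norm (fun n => Φ₁ x n - Φ₂ x n) ≤ (C₁ + C₂ + CΦ₁ + CΦ₂) * ‖x‖ := by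
  intro x hx
  rcases eq_or_ne x 0 with rfl | hx0
  · have h₁ := hΦ₁_homog 0 0 hx
    have h₂ := hΦ₂_homog 0 0 hx
    rw [zero_smul, zero_smul] at h₁ h₂
    simp [l1Norm, h₁, h₂]
  have hpos : 0 < ‖x‖ := norm_pos_iff.mpr hx0
  have hC₁ : 0 ≤ C₁ :=
    nonneg_of_mul_nonneg_left ((abs_nonneg _).trans (hΦ₁_approx x hx)) hpos
  have hC₂ : 0 ≤ C₂ :=
    nonneg_of_mul_nonneg_left ((abs_nonneg _).trans (hΦ₂_approx x hx)) hpos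
  have hCΦ₁ : 0 ≤ CΦ₁ := by
    have h := (l1Norm_nonneg _).trans (hΦ₁_cent 1 x hx)
    rw [norm_one, mul_one] at h
    exact nonneg_of_mul_nonneg_left h hpos
  have hCΦ₂ : 0 ≤ CΦ₂ := by
    have h := (l1Norm_nonneg _).trans (hΦ₂_cent 1 x hx)
    rw [norm_one, mul_one] at h
    exact nonneg_of_mul_nonneg_left h hpos
  set a : Linf := signLp fun n => Φ₁ x n - Φ₂ x n with ha
  have ha1 : ‖a‖ ≤ 1 := norm_signLp_le_one _
  have hy : FinSuppX (a • x) := hx.smul a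
  have hyx : ‖a • x‖ ≤ ‖x‖ :=
    (hmod a x).trans (mul_le_of_le_one_left (norm_nonneg x) ha1)
  have s₁ := (hΦ₁_l1 _ hy).of_abs
  have s₂ := (hΦ₂_l1 _ hy).of_abs
  have t₁ := summable_linf_mul a (hΦ₁_l1 x hx)
  have t₂ := summable_linf_mul a (hΦ₂_l1 x hx)
  have hsum : l1Norm (fun n => Φ₁ x n - Φ₂ x n)
      = ∑' n, a n * Φ₁ x n - ∑' n, a n * Φ₂ x n := by
    rw [← t₁.tsum_sub t₂]
    refine tsum_congr fun n => ?_
    rw [← mul_sub, ha, signLp_apply, sign_mul_self]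
  have e₁ := (abs_tsum_le_l1Norm (s₁.sub t₁).abs).trans (hΦ₁_cent a x hx)
  have e₂ := (abs_tsum_le_l1Norm (s₂.sub t₂).abs).trans (hΦ₂_cent a x hx)
  rw [s₁.tsum_sub t₁] at e₁
  rw [s₂.tsum_sub t₂] at e₂
  have b₁ : CΦ₁ * ‖a‖ * ‖x‖ ≤ CΦ₁ * ‖x‖ := by
    gcongr
    exact mul_le_of_le_one_right hCΦ₁ ha1
  have b₂ : CΦ₂ * ‖a‖ * ‖x‖ ≤ CΦ₂ * ‖x‖ := by
    gcongr
    exact mul_le_of_le_one_right hCΦ₂ ha1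
  have f₁ := (hΦ₁_approx _ hy).trans (mul_le_mul_of_nonneg_left hyx hC₁)
  have f₂ := (hΦ₂_approx _ hy).trans (mul_le_mul_of_nonneg_left hyx hC₂)
  rw [abs_le] at e₁ e₂ f₁ f₂
  rw [hsum]
  linarith [e₁.1, e₂.2, f₁.1, f₂.2]
end
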